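/- There exists a primitive, proper and recognizable directive sequence τ = (τ_n : A_{n+1}* → A_n*)_{n≥0} with A_0 = {0,1} and |A_{n+1}| = 2 for every n ≥ 0, such that X_τ is an aperiodic Toeplitz subshift (hence a Toeplitz subshift of topological rank 2) which is not a strong Toeplitz subshift of rank 2; that is, X_τ is not conjugate to X_σ for any constant-length, primitive, proper and recognizable directive sequence σ of alphabet rank at most 2. -/

import Mathlib

namespace ToeplitzFR

open Set

variable {A B C : Type*}

/-- The shift map `S` on `ℤ → A`: `S(x)(i) = x(i+1)`. -/
def shift (x : ℤ → A) : ℤ → A := fun i => x (i + 1)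

/-- The inverse shift map `S⁻¹`. -/
def shiftInv (x : ℤ → A) : ℤ → A := fun i => x (i - 1)

/-- The shift by `k`: `S^k`. -/
def shiftBy (k : ℤ) (x : ℤ → A) : ℤ → A := fun i => x (i + k)

/-- The finite word `x[i, i+n)`. -/
def factorAt (x : ℤ → A) (i : ℤ) (n : ℕ) : List A :=
  (List.range n).map fun j => x (i + j)

/-- `x` is a periodic point of the shift. -/
def IsPeriodicPoint (x : ℤ → A) : Prop := ∃ p : ℕ, 0 < p ∧ ∀ i : ℤ, x (i + p) = x i

def IsAperiodicPoint (x : ℤ → A) : Prop := ¬ IsPeriodicPoint x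

/-- `Per_p(x)`. -/
def PerSet (x : ℤ → A) (p : ℕ) : Set ℤ := {i : ℤ | ∀ k : ℤ, x (i + k * p) = x i}

/-- `Per(x) = ⋃_{p>1} Per_p(x)`. -/
def PerAll (x : ℤ → A) : Set ℤ := {i : ℤ | ∃ p : ℕ, 1 < p ∧ i ∈ PerSet x p}

/-- `x` is a Toeplitz sequence. -/
def IsToeplitz (x : ℤ → A) : Prop := ∀ i : ℤ, ∃ p : ℕ, 1 < p ∧ i ∈ PerSet x p

/-- The shift orbit of `x`. -/
def orbit (x : ℤ → A) : Set (ℤ → A) := {y | ∃ k : ℤ, y = shiftBy k x}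

/-- `X` is the Toeplitz subshift generated by the Toeplitz sequence `x`. -/
def ToeplitzGenerates [TopologicalSpace A] (x : ℤ → A) (X : Set (ℤ → A)) : Prop :=
  IsToeplitz x ∧ X = closure (orbit x)

/-- `X` is a Toeplitz subshift. -/
def IsToeplitzSubshift [TopologicalSpace A] (X : Set (ℤ → A)) : Prop :=
  ∃ x : ℤ → A, ToeplitzGenerates x X

/-- The `p`-skeleton of `x`, with `none` as the blank symbol. -/
noncomputable def Skel (x : ℤ → A) (p : ℕ) : ℤ → Option A :=
  fun i => @ite _ (i ∈ PerSet x p) (Classical.dec _) (some (x i)) none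

/-- `p` is an essential period of `x`. -/
def IsEssentialPeriod (x : ℤ → A) (p : ℕ) : Prop :=
  1 < p ∧ ∀ q : ℕ, 0 < q → q < p → ∃ i : ℤ, Skel x p (i + q) ≠ Skel x p i

/-- `(P n)` is a period structure for `x`. -/
def IsPeriodStructure (x : ℤ → A) (P : ℕ → ℕ) : Prop :=
  StrictMono P ∧ (∀ n, IsEssentialPeriod x (P n)) ∧ (∀ n, P n ∣ P (n+1)) ∧
    ∀ i : ℤ, ∃ n, i ∈ PerSet x (P n)

/-- `q` divides the scale of the Toeplitz subshift `X`. -/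
def DividesScale [TopologicalSpace A] (X : Set (ℤ → A)) (q : ℕ) : Prop :=
  ∃ (x : ℤ → A) (P : ℕ → ℕ),
    ToeplitzGenerates x X ∧ IsPeriodStructure x P ∧ ∃ n, q ∣ P n

/-! ### Directive sequences and S-adic subshifts -/

/-- All morphisms in the directive sequence are non-erasing. -/
def NonErasing {A : ℕ → Type*} (τ : ∀ n, A (n+1) → List (A n)) : Prop :=
  ∀ n a, τ n a ≠ []

/-- The directive sequence has constant length. -/
def ConstantLength {A : ℕ → Type*} (τ : ∀ n, A (n+1) → List (A n)) : Prop :=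
  ∀ n, ∀ a b : A (n+1), (τ n a).length = (τ n b).length

/-- The directive sequence is proper. -/
def ProperSeq {A : ℕ → Type*} (τ : ∀ n, A (n+1) → List (A n)) : Prop :=
  ∀ n, ∃ b c : A n, ∀ a : A (n+1), (τ n a).head? = some b ∧ (τ n a).getLast? = some c

/-- `sadicWordAux τ n k a = τ_{[n, n+k)}(a)`. -/
def sadicWordAux {A : ℕ → Type*} (τ : ∀ n, A (n+1) → List (A n)) (n : ℕ) :
    ∀ k : ℕ, A (n + k) → List (A n)
  | 0, a => [a]
  | (k+1), a => (τ (n+k) a).flatMap (sadicWordAux τ n k)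

/-- `word0 τ k a = τ_{[0, k)}(a)` for `a ∈ A k`. -/
def word0 {A : ℕ → Type*} (τ : ∀ n, A (n+1) → List (A n)) :
    ∀ k : ℕ, A k → List (A 0)
  | 0, a => [a]
  | (k+1), a => (τ k a).flatMap (word0 τ k)

/-- The directive sequence is primitive. -/
def PrimitiveSeq {A : ℕ → Type*} (τ : ∀ n, A (n+1) → List (A n)) : Prop :=
  ∀ n, ∃ k : ℕ, 0 < k ∧ ∀ (a : A (n+k)) (b : A n), b ∈ sadicWordAux τ n k a

/-- The `n`-th level `X_τ^{(n)}` of the S-adic system generated by `τ`. -/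
def XLevel {A : ℕ → Type*} (τ : ∀ n, A (n+1) → List (A n)) (n : ℕ) :
    Set (ℤ → A n) :=
  {y | ∀ (i : ℤ) (m : ℕ), ∃ k : ℕ, 0 < k ∧ ∃ a : A (n+k),
      (factorAt y i m).IsInfix (sadicWordAux τ n k a)}

/-- The alphabet rank (`liminf_n |A_n|`) is at most `K`. -/
def AlphabetRankLE (A : ℕ → Type*) [∀ n, Fintype (A n)] (K : ℕ) : Prop :=
  ∀ N : ℕ, ∃ n, N ≤ n ∧ Fintype.card (A n) ≤ K

/-! ### Recognizability -/

/-- `z` is the bi-infinite concatenation `⋯σ(y(-1)).σ(y(0))σ(y(1))⋯`,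
with `σ(y(0))` starting at coordinate `0`. -/
def IsConcat (σ : B → List C) (y : ℤ → B) (z : ℤ → C) : Prop :=
  ∃ c : ℤ → ℤ, c 0 = 0 ∧ (∀ j : ℤ, c (j + 1) = c j + (σ (y j)).length) ∧
    ∀ (j : ℤ) (m : Fin (σ (y j)).length), z (c j + (m : ℕ)) = (σ (y j)).get m

/-- `(y, k)` is a centered `σ`-representation of `x` in `Y`. -/
def IsCenteredRep (σ : B → List C) (Y : Set (ℤ → B)) (x : ℤ → C)
    (y : ℤ → B) (k : ℕ) : Prop :=
  y ∈ Y ∧ k < (σ (y 0)).length ∧ IsConcat σ y (fun m => x (m - k))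

/-- The morphism `σ` is recognizable in `Y`. -/
def RecognizableIn (σ : B → List C) (Y : Set (ℤ → B)) : Prop :=
  ∀ (x : ℤ → C) (y y' : ℤ → B) (k k' : ℕ),
    IsCenteredRep σ Y x y k → IsCenteredRep σ Y x y' k' → y = y' ∧ k = k'

/-- The directive sequence `τ` is recognizable. -/
def RecognizableSeq {A : ℕ → Type*} (τ : ∀ n, A (n+1) → List (A n)) : Prop :=
  ∀ n, RecognizableIn (τ n) (XLevel τ (n+1))

/-! ### Conjugacy -/

/-- `(X, TX)` and `(Y, TY)` are conjugate via a homeomorphism. -/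
def ConjugateBy [TopologicalSpace A] [TopologicalSpace B]
    (X : Set (ℤ → A)) (Y : Set (ℤ → B))
    (TX : (ℤ → A) → (ℤ → A)) (TY : (ℤ → B) → (ℤ → B)) : Prop :=
  ∃ φ : ↥X ≃ₜ ↥Y, ∀ (x : ℤ → A) (hx : x ∈ X) (hx' : TX x ∈ X),
    (φ ⟨TX x, hx'⟩).1 = TY (φ ⟨x, hx⟩).1

/-- `(X, S)` and `(Y, S)` are conjugate subshifts. -/
def Conjugate [TopologicalSpace A] [TopologicalSpace B]
    (X : Set (ℤ → A)) (Y : Set (ℤ → B)) : Prop :=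
  ConjugateBy X Y shift shift

/-- `X` is a strong Toeplitz subshift of rank `K`: it is conjugate to the S-adic subshift
of a constant-length, primitive, proper and recognizable directive sequence of
alphabet rank at most `K`. -/
def IsStrongToeplitzOfRank [TopologicalSpace A] (X : Set (ℤ → A)) (K : ℕ) : Prop :=
  ∃ (B : ℕ → Type) (iB : ∀ n, Fintype (B n)) (σ : ∀ n, B (n+1) → List (B n)),
    NonErasing σ ∧ ConstantLength σ ∧ PrimitiveSeq σ ∧ ProperSeq σ ∧
    RecognizableSeq σ ∧ @AlphabetRankLE B iB K ∧
    @Conjugate A (B 0) _ ⊥ X (XLevel σ 0)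

/-- `X` is conjugate to the S-adic subshift of a primitive, proper and recognizable
directive sequence of alphabet rank at most `K`. -/
def HasFiniteRankSAdicRep [TopologicalSpace A] (X : Set (ℤ → A)) (K : ℕ) : Prop :=
  ∃ (B : ℕ → Type) (iB : ∀ n, Fintype (B n)) (σ : ∀ n, B (n+1) → List (B n)),
    NonErasing σ ∧ PrimitiveSeq σ ∧ ProperSeq σ ∧
    RecognizableSeq σ ∧ @AlphabetRankLE B iB K ∧
    @Conjugate A (B 0) _ ⊥ X (XLevel σ 0)

/-! ### Cuts, languages, built-from -/

/-- The set of words `{x[t+kp, t+(k+1)p) : k ∈ ℤ}`. -/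
def cutWords (x : ℤ → A) (p t : ℕ) : Set (List A) :=
  {w | ∃ k : ℤ, w = factorAt x ((t : ℤ) + k * p) p}

/-- `(p, t)` is a strong rank-2 cut of `x`. -/
def StrongRank2Cut (x : ℤ → A) (p t : ℕ) : Prop :=
  t < p ∧ ∃ u v : List A, u ≠ v ∧ cutWords x p t = {u, v}

/-- The language `L_n(X)`. -/
def Lang (n : ℕ) (X : Set (ℤ → A)) : Set (List A) :=
  {w | ∃ x ∈ X, ∃ i : ℤ, w = factorAt x i n}

/-- The maximal common prefix of `u` and `v` has length greater than `m`. -/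
def CommonPrefixLongerThan (u v : List A) (m : ℕ) : Prop :=
  m + 1 ≤ u.length ∧ m + 1 ≤ v.length ∧ u.take (m+1) = v.take (m+1)

/-- The maximal common suffix of `u` and `v` has length greater than `m`. -/
def CommonSuffixLongerThan (u v : List A) (m : ℕ) : Prop :=
  CommonPrefixLongerThan u.reverse v.reverse m

/-- `b = (β₀, (α₁, …, α_k), β₁)` is a building of the word `w` from `W`:
`w = β₀α₁⋯α_kβ₁`, all `αᵢ ∈ W`, `β₀` is a proper suffix of an element of `W`,
and `β₁` is a proper prefix of an element of `W`. -/
def IsBuilding (W : Set (List A)) (w : List A)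
    (b : List A × List (List A) × List A) : Prop :=
  w = b.1 ++ b.2.1.flatten ++ b.2.2 ∧ (∀ α ∈ b.2.1, α ∈ W) ∧
  (∃ u ∈ W, b.1 <:+ u ∧ b.1 ≠ u) ∧ (∃ u ∈ W, b.2.2 <+: u ∧ b.2.2 ≠ u)

/-- `w` is uniquely built from `W`. -/
def UniquelyBuiltFrom (W : Set (List A)) (w : List A) : Prop :=
  ∃! b : List A × List (List A) × List A, IsBuilding W w b

/-- `X` together with one of its points satisfies the strong rank-2 cut property. -/
def GoodCuts [TopologicalSpace A] (X : Set (ℤ → A)) (x : ℤ → A) : Prop :=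
  ∀ p : ℕ, 0 < p → DividesScale X p → ∀ m : ℕ,
    ∃ q t : ℕ, StrongRank2Cut x q t ∧ p ∣ q ∧ DividesScale X q ∧
      ∃ u v : List A, u ≠ v ∧ cutWords x q t = {u, v} ∧
        CommonPrefixLongerThan u v m ∧ CommonSuffixLongerThan u v m

/-! ### Euclidean pairs and buildings of bi-infinite sequences -/

/-- `{u, v}` is a Euclidean pair. -/
def EuclideanPair (u v : List A) : Prop :=
  ∃ (w : List A) (k l : ℕ),
    u = (List.replicate k w).flatten ∧ v = (List.replicate l w).flatten

/-- `α` is the distinguished prefix of `u` and `v`. -/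
def IsDistinguishedPrefix (u v α : List A) : Prop :=
  α.length < u.length + v.length ∧
  ∀ x y : List A,
    (∃ l : List (List A), (∀ w ∈ l, w = u ∨ w = v) ∧ x = u ++ l.flatten) →
    (∃ l : List (List A), (∀ w ∈ l, w = u ∨ w = v) ∧ y = v ++ l.flatten) →
    α.length + 1 ≤ x.length → α.length + 1 ≤ y.length →
    α <+: x ∧ α <+: y ∧ x[α.length]? ≠ y[α.length]?

/-- `β` is the distinguished suffix of `u` and `v`. -/
def IsDistinguishedSuffix (u v β : List A) : Prop :=
  IsDistinguishedPrefix u.reverse v.reverse β.reverse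

/-- `(c, f)` is a building of the bi-infinite sequence `x` from `W`:
block `j` starts at position `c j` and carries the word `f j ∈ W`. -/
def IsBuildingSeq (W : Set (List A)) (x : ℤ → A) (c : ℤ → ℤ) (f : ℤ → List A) : Prop :=
  (∀ j : ℤ, f j ∈ W) ∧ (∀ j : ℤ, c (j + 1) = c j + (f j).length) ∧
  ∀ (j : ℤ) (m : Fin (f j).length), x (c j + (m : ℕ)) = (f j).get m

/-- The subshift `X_{u,v}` of all sequences built from `{u, v}`. -/
def Xuv (u v : List A) : Set (ℤ → A) :=
  {x | ∃ (c : ℤ → ℤ) (f : ℤ → List A), IsBuildingSeq {u, v} x c f}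

/-! ### Block-code conjugacies -/

/-- A conjugacy `φ : X → Y` admitting block width `2n+1`. -/
structure BlockConjugacy (A : Type*) (X Y : Set (ℤ → A)) (n : ℕ) where
  toFun : (ℤ → A) → (ℤ → A)
  invFun : (ℤ → A) → (ℤ → A)
  maps_to : ∀ x ∈ X, toFun x ∈ Y
  maps_from : ∀ y ∈ Y, invFun y ∈ X
  left_inv : ∀ x ∈ X, invFun (toFun x) = x
  right_inv : ∀ y ∈ Y, toFun (invFun y) = y
  shift_comm : ∀ x ∈ X, toFun (shift x) = shift (toFun x)
  code : List A → A
  code_inv : List A → A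
  code_spec : ∀ x ∈ X, ∀ i : ℤ, toFun x i = code (factorAt x (i - n) (2*n+1))
  code_inv_spec : ∀ y ∈ Y, ∀ i : ℤ, invFun y i = code_inv (factorAt y (i - n) (2*n+1))

/-! ### Parts, permutation action, χ -/

/-- `W` is a member of `Parts(X, p)`: a class of the common-`p`-skeleton relation. -/
def SkelClass (X : Set (ℤ → A)) (p : ℕ) (W : Set (ℤ → A)) : Prop :=
  ∃ y ∈ X, W = {z ∈ X | Skel z p = Skel y p}

/-- The map `ψ̂` induced by a permutation `ψ` of `A^p`. -/
def permHat (p : ℕ) (ψ : Equiv.Perm (Fin p → A)) (x : ℤ → A) : ℤ → A :=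
  fun i =>
    if h : (i.emod p).toNat < p then
      ψ (fun m : Fin p => x (i - i.emod p + (m : ℕ))) ⟨(i.emod p).toNat, h⟩
    else x i

/-- The relation `E_p` on compact subsets of `A^ℤ`. -/
def EpRel (p : ℕ) (K L : Set (ℤ → A)) : Prop :=
  ∃ ψ : Equiv.Perm (Fin p → A), L = permHat p ψ '' K

/-- `W ∈ Parts_*(X, p)`. -/
def SkelClassStar (X : Set (ℤ → A)) (p : ℕ) (W : Set (ℤ → A)) : Prop :=
  SkelClass X p W ∧ ∀ y ∈ W, Skel y p (-1) = none ∧ Skel y p 0 ≠ none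

/-- `length(W) = L` for `W ∈ Parts_*(X, p)`. -/
def HasLength (p : ℕ) (W : Set (ℤ → A)) (L : ℕ) : Prop :=
  ∀ y ∈ W, (∀ i : ℕ, i < L → Skel y p (i : ℤ) ≠ none) ∧ Skel y p (L : ℤ) = none

/-- `Z ∈ χ(X, p)`. -/
def ChiMem (X : Set (ℤ → A)) (p : ℕ) (Z : Set (ℤ → A)) : Prop :=
  ∃ (W : Set (ℤ → A)) (L : ℕ), SkelClassStar X p W ∧ HasLength p W L ∧
    (∀ (W' : Set (ℤ → A)) (L' : ℕ),
      SkelClassStar X p W' → HasLength p W' L' → L' ≤ L) ∧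
    Z = shiftBy ((L / 2 : ℕ) : ℤ) '' W

/-- `χ(X, p) E_p^fin χ(Y, p)`. -/
def ChiEpFin (X Y : Set (ℤ → A)) (p : ℕ) : Prop :=
  (∀ K, ChiMem X p K → ∃ L, ChiMem Y p L ∧ EpRel p K L) ∧
  (∀ L, ChiMem Y p L → ∃ K, ChiMem X p K ∧ EpRel p K L)

/-! ### Single holes and fillings -/

/-- The Toeplitz sequence `x` has single holes with respect to the period structure `P`. -/
def SingleHoles (x : ℤ → A) (P : ℕ → ℕ) : Prop :=
  IsPeriodStructure x P ∧
  ∀ n, ∃! i : ℤ, 0 ≤ i ∧ i < (P n : ℤ) ∧ i ∉ PerSet x (P n)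

/-- The Toeplitz subshift `X` has single holes. -/
def HasSingleHoles [TopologicalSpace A] (X : Set (ℤ → A)) : Prop :=
  ∃ (x : ℤ → A) (P : ℕ → ℕ), ToeplitzGenerates x X ∧ SingleHoles x P

/-- `w` is the `(n, m)`-filling of `x` (for periods `pn < pm`). -/
def IsFilling (x : ℤ → A) (pn pm : ℕ) (w : List A) : Prop :=
  w.length = pm / pn - 1 ∧
  ∀ h : ℤ, 0 ≤ h → h < (pm : ℤ) → h ∉ PerSet x pm →
    ∀ (j : ℕ) (hj : j < w.length), w.get ⟨j, hj⟩ = x (h + (j+1) * pn)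

/-- `u` is a `θ`-palindrome. -/
def ThetaPalindrome (θ : Equiv.Perm A) (u : List A) : Prop :=
  u.map (fun a => θ a) = u.reverse

/-! ### Nice symmetries -/

/-- `x` has nice symmetries with respect to `(p, q)`. -/
def NiceSymmetries (x : ℤ → A) (p q : ℕ) : Prop :=
  ∃ m : ℤ, 1 < m ∧ m ≤ (q : ℤ) + 1 ∧
    (∀ k : ℕ, k < q / p →
      (Set.Ico ((k * p : ℕ) : ℤ) (((k+1) * p : ℕ) : ℤ) ⊆ PerSet x q ↔
       Set.Ico (m - ((k+1) * p : ℕ)) (m - (k * p : ℕ)) ⊆ PerSet x q)) ∧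
    (∀ k k' : ℕ, k < q / p → k' < q / p →
      Set.Ico ((k * p : ℕ) : ℤ) (((k+1) * p : ℕ) : ℤ) ⊆ PerSet x q →
      Set.Ico ((k' * p : ℕ) : ℤ) (((k'+1) * p : ℕ) : ℤ) ⊆ PerSet x q →
      (factorAt x ((k * p : ℕ) : ℤ) p = factorAt x ((k' * p : ℕ) : ℤ) p ↔
       factorAt x (m - ((k+1) * p : ℕ)) p = factorAt x (m - ((k'+1) * p : ℕ)) p))

/-- For some `p` dividing the scale of `X`, `x` has nice symmetries with respect to
`(p, q)` for all `q > p` with `p ∣ q` dividing the scale of `X`. -/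
def NiceSymAll [TopologicalSpace A] (X : Set (ℤ → A)) (x : ℤ → A) : Prop :=
  ∃ p : ℕ, 0 < p ∧ DividesScale X p ∧
    ∀ q : ℕ, p < q → p ∣ q → DividesScale X q → NiceSymmetries x p q

/-- A pair `(x, x')` is a centered left asymptotic pair. -/
def CenteredLeftAsymptoticPair (x x' : ℤ → A) : Prop :=
  (∀ i : ℤ, i < 0 → x i = x' i) ∧ x 0 ≠ x' 0

/-! ### Automorphism groups -/

/-- `e` is an automorphism of the subshift `(X, S)`. -/
def IsShiftAutomorphism [TopologicalSpace A] (X : Set (ℤ → A)) (e : ↥X ≃ₜ ↥X) : Prop :=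
  ∀ (x : ℤ → A) (hx : x ∈ X) (hx' : shift x ∈ X),
    (e ⟨shift x, hx'⟩).1 = shift (e ⟨x, hx⟩).1

/-- The automorphism group of `(X, S)` is isomorphic, as a group, to `ℤ × ℤ/nℤ`. -/
def AutGroupIsoZxZmod [TopologicalSpace A] (X : Set (ℤ → A)) (n : ℕ) : Prop :=
  ∃ Φ : {e : ↥X ≃ₜ ↥X // IsShiftAutomorphism X e} → ℤ × ZMod n,
    Function.Bijective Φ ∧
    ∀ e f g : {e : ↥X ≃ₜ ↥X // IsShiftAutomorphism X e},
      (∀ z : ↥X, g.1 z = e.1 (f.1 z)) → Φ g = Φ e + Φ f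

/-! ### The Polish space of subshifts over `ℤ` -/

/-- A point of the space `𝐒` of all (compact, nonempty, shift-invariant) subshifts
over finite alphabets contained in `ℤ`. -/
structure SubshiftSpace : Type where
  carrier : Set (ℤ → ℤ)
  nonempty : carrier.Nonempty
  compact : IsCompact carrier
  invariant : shift '' carrier = carrier

/-- The topology on `𝐒` induced by the languages `(L_n(X))_{n}`, with each
family of `n`-languages discrete; this coincides with the metric
`d(X,Y) = 2^{-min{n : L_n(X) ≠ L_n(Y)}}`. -/
instance : TopologicalSpace SubshiftSpace :=
  TopologicalSpace.induced
    (fun X : SubshiftSpace => (fun n => Lang n X.carrier : ℕ → Set (List ℤ)))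
    (@Pi.topologicalSpace ℕ (fun _ => Set (List ℤ)) (fun _ => ⊥))

/-- The subset `𝐌 ⊆ 𝐒` of infinite minimal subshifts. -/
def MinimalSet : Set SubshiftSpace :=
  {X | X.carrier.Infinite ∧ ∀ x ∈ X.carrier, X.carrier ⊆ closure (orbit x)}


/-! ### Generic tools -/

theorem cyl_of_open [TopologicalSpace B] [DiscreteTopology B] {U : Set (ℤ → B)} (hU : IsOpen U)
    {z : ℤ → B} (hz : z ∈ U) :
    ∃ m : ℕ, ∀ x : ℤ → B, (∀ i : ℤ, -(m:ℤ) ≤ i → i ≤ m → x i = z i) → x ∈ U := by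
  rw [isOpen_pi_iff] at hU
  obtain ⟨I, u, hu, hsub⟩ := hU z hz
  refine ⟨I.sup Int.natAbs, fun x hx => hsub ?_⟩
  intro i hi
  have h1 : i.natAbs ≤ I.sup Int.natAbs := Finset.le_sup (f := Int.natAbs) hi
  have : x i = z i := hx i (by omega) (by omega)
  rw [this]
  exact (hu i hi).2

theorem isOpen_cyl [TopologicalSpace B] [DiscreteTopology B] (z : ℤ → B) (m : ℕ) :
    IsOpen {x : ℤ → B | ∀ i : ℤ, -(m:ℤ) ≤ i → i ≤ m → x i = z i} := by
  have : {x : ℤ → B | ∀ i : ℤ, -(m:ℤ) ≤ i → i ≤ m → x i = z i} =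
      Set.pi (Finset.Icc (-(m:ℤ)) m : Finset ℤ) (fun i => {z i}) := by
    ext x; simp [Set.pi]
  rw [this]
  exact isOpen_set_pi (Finset.finite_toSet _) (fun _ _ => isOpen_discrete _)

theorem konig {B : Type*} [Finite B] (w : ℕ → ℤ → B) :
    ∃ z : ℤ → B, ∀ m : ℕ, ∃ N, m ≤ N ∧ ∀ i : ℤ, -(m:ℤ) ≤ i → i ≤ m → w N i = z i := by
  let : TopologicalSpace B := ⊥
  have : DiscreteTopology B := ⟨rfl⟩
  obtain ⟨z, -, hz⟩ := (isCompact_univ : IsCompact (Set.univ : Set (ℤ → B))) 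
    (f := Filter.map w Filter.atTop) (by simp)
  refine ⟨z, fun m => ?_⟩
  have h1 : {x : ℤ → B | ∀ i : ℤ, -(m:ℤ) ≤ i → i ≤ m → x i = z i} ∈ nhds z :=
    (isOpen_cyl z m).mem_nhds (fun _ _ _ => rfl)
  have h2 := (mapClusterPt_iff_frequently.1 hz) _ h1
  obtain ⟨N, hN, h⟩ := (Filter.frequently_atTop.1 h2) m
  exact ⟨N, hN, h⟩

theorem mem_closure_cyl [TopologicalSpace B] [DiscreteTopology B] (S : Set (ℤ → B)) (z : ℤ → B) :
    z ∈ closure S ↔ ∀ m : ℕ, ∃ s ∈ S, ∀ i : ℤ, -(m:ℤ) ≤ i → i ≤ m → s i = z i := by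
  rw [mem_closure_iff]
  constructor
  · intro h m
    obtain ⟨s, hs, hS⟩ := h _ (isOpen_cyl z m) (fun _ _ _ => rfl)
    exact ⟨s, hS, hs⟩
  · intro h U hU hz
    obtain ⟨m, hm⟩ := cyl_of_open hU hz
    obtain ⟨s, hs, h2⟩ := h m
    exact ⟨s, hm s h2, hs⟩

/-- Two points agree on arbitrarily long windows. -/
def Prox (y y' : ℤ → B) : Prop :=
  ∀ m : ℕ, ∃ k : ℤ, ∀ i : ℤ, -(m:ℤ) ≤ i → i ≤ m → y (k + i) = y' (k + i)

theorem factorAt_eq (x : ℤ → B) (i : ℤ) (m : ℕ) :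
    factorAt x i m = (List.range m).map (fun j : ℕ => x (i + (j:ℤ))) := by
  unfold factorAt
  simp only [List.bind_eq_flatMap, List.pure_def, List.map_flatMap, List.map_cons, List.map_nil]
  rw [← List.map_eq_flatMap]

theorem factorAt_shiftBy (k : ℤ) (x : ℤ → B) (i : ℤ) (m : ℕ) :
    factorAt (shiftBy k x) i m = factorAt x (i + k) m := by
  simp only [factorAt_eq, shiftBy]
  apply List.map_congr_left
  intro j _
  congr 1; ring

theorem factorAt_congr {x y : ℤ → B} {i : ℤ} {m : ℕ}
    (h : ∀ j : ℤ, i ≤ j → j < i + m → x j = y j) : factorAt x i m = factorAt y i m := by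
  simp only [factorAt_eq]
  apply List.map_congr_left
  intro j hj
  have := List.mem_range.1 hj
  exact h _ (by omega) (by omega)

theorem XLevel_shiftBy {A : ℕ → Type*} (τ : ∀ n, A (n+1) → List (A n)) (n : ℕ) {y : ℤ → A n}
    (hy : y ∈ XLevel τ n) (k : ℤ) : shiftBy k y ∈ XLevel τ n := by
  intro i m
  rw [factorAt_shiftBy]
  exact hy _ m

/-- closedness of the levels, combinatorially -/
theorem XLevel_of_approx {A : ℕ → Type*} (τ : ∀ n, A (n+1) → List (A n)) (n : ℕ) {z : ℤ → A n}
    (h : ∀ m : ℕ, ∃ y ∈ XLevel τ n, ∀ i : ℤ, -(m:ℤ) ≤ i → i ≤ m → y i = z i) :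
    z ∈ XLevel τ n := by
  intro i m
  obtain ⟨y, hy, hz⟩ := h (i.natAbs + m)
  rw [← factorAt_congr (x := y)]
  · exact hy i m
  · intro j h1 h2
    exact hz j (by omega) (by omega)

/-- sliding block code property of a conjugacy -/
theorem conj_local {A : ℕ → Type} [Finite (A 0)] {C : Type}
    (τ : ∀ n, A (n+1) → List (A n)) (tA : TopologicalSpace (A 0))
    (hA : DiscreteTopology (A 0)) (tC : TopologicalSpace C) (hC : DiscreteTopology C)
    (Y : Set (ℤ → C)) (φ : ↥(XLevel τ 0) ≃ₜ ↥Y) :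
    ∃ m : ℕ, ∀ x x' : ↥(XLevel τ 0), (∀ i : ℤ, -(m:ℤ) ≤ i → i ≤ m → x.1 i = x'.1 i) →
      (φ x).1 0 = (φ x').1 0 := by
  by_contra hcon
  push Not at hcon
  choose x x' hx hne using hcon
  obtain ⟨z, hz⟩ := konig (fun N => (x N).1)
  have hzX : z ∈ XLevel τ 0 := by
    apply XLevel_of_approx
    intro m
    obtain ⟨N, -, hN⟩ := hz m
    exact ⟨_, (x N).2, hN⟩
  have hopen : IsOpen {x : ↥(XLevel τ 0) | (φ x).1 0 = (φ ⟨z, hzX⟩).1 0} := by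
    have hc : Continuous (fun x : ↥(XLevel τ 0) => (φ x).1 0) :=
      (continuous_apply 0).comp (continuous_subtype_val.comp φ.continuous)
    exact (isOpen_discrete ({(φ ⟨z, hzX⟩).1 0} : Set C)).preimage hc
  obtain ⟨U, hU, hUe⟩ := isOpen_induced_iff.1 hopen
  have hzU : z ∈ U := by
    have : (⟨z, hzX⟩ : ↥(XLevel τ 0)) ∈ Subtype.val ⁻¹' U := by
      rw [hUe]; rfl
    exact this
  obtain ⟨m, hm⟩ := cyl_of_open hU hzU
  obtain ⟨N, hmN, hN⟩ := hz m
  have key : ∀ y : ↥(XLevel τ 0), (∀ i : ℤ, -(m:ℤ) ≤ i → i ≤ m → y.1 i = z i) →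
      (φ y).1 0 = (φ ⟨z, hzX⟩).1 0 := by
    intro y hy
    have : y ∈ Subtype.val ⁻¹' U := hm _ hy
    rw [hUe] at this
    exact this
  apply hne N
  rw [key (x N) hN, key (x' N)]
  intro i h1 h2
  rw [← hx N i (by omega) (by omega)]
  exact hN i h1 h2

theorem shift_iter (k : ℕ) (x : ℤ → B) : shift (shiftBy (k:ℤ) x) = shiftBy ((k+1:ℕ):ℤ) x := by
  funext i
  simp only [shift, shiftBy]
  congr 1; push_cast; ring

theorem conj_shiftBy {A : ℕ → Type} {C : Type}
    (τ : ∀ n, A (n+1) → List (A n)) 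
    (Y : Set (ℤ → C)) (φ : ↥(XLevel τ 0) → ↥Y)
    (hφ : ∀ (x : ℤ → A 0) (hx : x ∈ XLevel τ 0) (hx' : shift x ∈ XLevel τ 0),
      (φ ⟨shift x, hx'⟩).1 = shift (φ ⟨x, hx⟩).1) (k : ℤ) (x : ↥(XLevel τ 0)) :
    (φ ⟨shiftBy k x.1, XLevel_shiftBy τ 0 x.2 k⟩).1 = shiftBy k (φ x).1 := by
  have hnat : ∀ (k : ℕ) (x : ↥(XLevel τ 0)),
      (φ ⟨shiftBy (k:ℤ) x.1, XLevel_shiftBy τ 0 x.2 k⟩).1 = shiftBy (k:ℤ) (φ x).1 := by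
    intro k x
    induction k with
    | zero =>
      have : (⟨shiftBy ((0:ℕ):ℤ) x.1, XLevel_shiftBy τ 0 x.2 _⟩ : ↥(XLevel τ 0)) = x := by
        apply Subtype.ext; funext i; simp [shiftBy]
      rw [this]; funext i; simp [shiftBy]
    | succ k ih =>
      have h := hφ _ (XLevel_shiftBy τ 0 x.2 k)
        (by rw [shift_iter]; exact XLevel_shiftBy τ 0 x.2 _)
      rw [ih, shift_iter k (φ x).1] at h
      rw [← h]
      congr 2
      apply Subtype.ext
      exact (shift_iter k x.1).symm
  obtain ⟨n, rfl | rfl⟩ := Int.eq_nat_or_neg k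
  · exact hnat n x
  · have h := hnat n ⟨shiftBy (-(n:ℤ)) x.1, XLevel_shiftBy τ 0 x.2 _⟩
    have e : (⟨shiftBy (n:ℤ) (shiftBy (-(n:ℤ)) x.1),
        XLevel_shiftBy τ 0 (XLevel_shiftBy τ 0 x.2 _) _⟩ : ↥(XLevel τ 0)) = x := by
      apply Subtype.ext; funext i; simp [shiftBy]
    simp only [e] at h
    rw [h]
    funext i; simp [shiftBy]

theorem conj_prox {A : ℕ → Type} [Finite (A 0)] {C : Type}
    (τ : ∀ n, A (n+1) → List (A n)) (Y : Set (ℤ → C))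
    (hc : @Conjugate (A 0) C ⊥ ⊥ (XLevel τ 0) Y) (x : Fin 3 → ℤ → A 0)
    (hx : ∀ i, x i ∈ XLevel τ 0) (hp : ∀ i j, Prox (x i) (x j)) (hinj : Function.Injective x) :
    ∃ y : Fin 3 → ℤ → C, (∀ i, y i ∈ Y) ∧ (∀ i j, Prox (y i) (y j)) ∧ Function.Injective y := by
  let tA : TopologicalSpace (A 0) := ⊥
  let tC : TopologicalSpace C := ⊥
  have hA : DiscreteTopology (A 0) := ⟨rfl⟩
  have hC : DiscreteTopology C := ⟨rfl⟩
  obtain ⟨φ, hφ⟩ := hc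
  obtain ⟨M, hM⟩ := conj_local τ tA hA tC hC Y φ
  refine ⟨fun i => (φ ⟨x i, hx i⟩).1, fun i => (φ _).2, ?_, ?_⟩
  · intro i j m
    obtain ⟨k, hk⟩ := hp i j (m + M)
    refine ⟨k, fun l h1 h2 => ?_⟩
    have e : ∀ i, (φ ⟨x i, hx i⟩).1 (k + l) =
        (φ ⟨shiftBy (k+l) (x i), XLevel_shiftBy τ 0 (hx i) _⟩).1 0 := by
      intro i
      rw [conj_shiftBy τ Y φ hφ (k+l) ⟨x i, hx i⟩]
      simp [shiftBy]
    simp only [e]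
    apply hM
    intro t h3 h4
    have := hk (l + t) (by push_cast; omega) (by push_cast; omega)
    simp only [shiftBy]
    convert this using 2 <;> ring
  · intro i j h
    have := φ.injective (Subtype.ext h)
    exact hinj (congrArg Subtype.val this)


/-! ### Constant length sequences -/

/-- `y = S^r σ(w)` for `σ` of constant length `ℓ`. -/
def IsEx (σ : B → List C) (ℓ r : ℕ) (w : ℤ → B) (y : ℤ → C) : Prop :=
  ∀ (j : ℤ) (m : ℕ), m < ℓ → (σ (w j))[m]? = some (y (j * ℓ + m - r))

theorem IsEx.centered {σ : B → List C} {ℓ r : ℕ} {w : ℤ → B} {y : ℤ → C} {Y : Set (ℤ → B)}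
    (hl : ∀ b, (σ b).length = ℓ) (h : IsEx σ ℓ r w y) (hr : r < ℓ) (hw : w ∈ Y) :
    IsCenteredRep σ Y y w r := by
  refine ⟨hw, by rw [hl]; exact hr, fun j => j * ℓ, by simp, ?_, ?_⟩
  · intro j; rw [hl]; ring
  · intro j m
    have h1 := h j m.1 (by rw [← hl (w j)]; exact m.2)
    rw [List.getElem?_eq_getElem m.2] at h1
    have h2 := Option.some.inj h1
    simp only [List.get_eq_getElem]
    exact h2.symm

theorem IsEx.shift {σ : B → List C} {ℓ r : ℕ} {w : ℤ → B} {y : ℤ → C} (h : IsEx σ ℓ r w y)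
    (k q : ℤ) (ρ : ℕ) (e : q * ℓ = r - ρ + k) : IsEx σ ℓ ρ (shiftBy q w) (shiftBy k y) := by
  intro j m hm
  simp only [shiftBy]
  rw [h (j + q) m hm]
  congr 2
  linear_combination e

theorem tau_cast {A : ℕ → Type*} (τ : ∀ n, A (n+1) → List (A n)) {M M' : ℕ} (h : M = M')
    (h1 : M + 1 = M' + 1) (a : A (M+1)) {D : Type*} (f : A M' → List D) :
    (τ M' (h1 ▸ a)).flatMap f = (τ M a).flatMap (fun b => f (h ▸ b)) := by
  subst h
  rfl

theorem sadic_split_aux {A : ℕ → Type*} (τ : ∀ n, A (n+1) → List (A n)) (n : ℕ) :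
    ∀ (k : ℕ) (h : n + (k+1) = n + 1 + k) (a : A (n + (k+1))),
      sadicWordAux τ n (k+1) a = (sadicWordAux τ (n+1) k (h ▸ a)).flatMap (τ n) := by
  intro k
  induction k with
  | zero =>
    intro h a
    simp [sadicWordAux]
  | succ k ih =>
    intro h a
    have h0 : n + (k+1) = n + 1 + k := by omega
    rw [sadicWordAux]
    rw [sadicWordAux.eq_def τ (n+1) (k+1)]
    simp only []
    rw [tau_cast τ h0 h a, List.flatMap_assoc]
    congr 1
    funext b
    exact ih h0 b

theorem sadic_split {A : ℕ → Type*} (τ : ∀ n, A (n+1) → List (A n)) (n k : ℕ)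
    (a : A (n + (k+1))) : ∃ a' : A (n+1+k),
      sadicWordAux τ n (k+1) a = (sadicWordAux τ (n+1) k a').flatMap (τ n) :=
  ⟨_, sadic_split_aux τ n k (by omega) a⟩

theorem flatMap_getElem? {σ : B → List C} {ℓ : ℕ} (hl : ∀ b, (σ b).length = ℓ) (u : List B)
    (J m : ℕ) (hm : m < ℓ) : (u.flatMap σ)[J * ℓ + m]? = u[J]?.bind (fun b => (σ b)[m]?) := by
  induction u generalizing J with
  | nil => simp
  | cons b u ih =>
    rw [List.flatMap_cons]
    cases J with
    | zero =>
      rw [List.getElem?_append_left (by rw [hl]; omega)]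
      simp
    | succ J =>
      have : (J + 1) * ℓ + m = ℓ + (J * ℓ + m) := by ring
      rw [this, List.getElem?_append_right (by rw [hl]; omega), hl]
      simp only [Nat.add_sub_cancel_left]
      rw [ih J]
      simp

theorem infix_of_getElem? (l u : List B) (s : ℕ)
    (h : ∀ j < l.length, u[s + j]? = l[j]?) : l <:+: u := by
  have : l = (u.drop s).take l.length := by
    apply List.ext_getElem?
    intro j
    rw [List.getElem?_take]
    split_ifs with hj
    · rw [List.getElem?_drop, h j hj]
    · exact List.getElem?_eq_none (by omega)
  rw [this]
  exact (List.take_prefix _ _).isInfix.trans (List.drop_suffix _ _).isInfix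

theorem factorAt_getElem? (x : ℤ → B) (i : ℤ) (m j : ℕ) (hj : j < m) :
    (factorAt x i m)[j]? = some (x (i + j)) := by
  simp [factorAt_eq, hj]

theorem factorAt_length (x : ℤ → B) (i : ℤ) (m : ℕ) : (factorAt x i m).length = m := by
  simp [factorAt_eq]

/-- finite desubstitution -/
theorem desub_fin {A : ℕ → Type} (τ : ∀ n, A (n+1) → List (A n)) (n ℓ : ℕ)
    (hl : ∀ b, (τ n b).length = ℓ) (hpos : 0 < ℓ) {y : ℤ → A n} (hy : y ∈ XLevel τ n)
    (N : ℕ) (hN : ℓ ≤ N) :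
    ∃ (w : ℤ → A (n+1)) (r : ℕ), r < ℓ ∧
      (∀ (j : ℤ) (m : ℕ), m < ℓ → -(N:ℤ) ≤ j * ℓ + m - r → j * ℓ + m - r ≤ N →
        (τ n (w j))[m]? = some (y (j * ℓ + m - r))) ∧
      (∀ (i : ℤ) (m : ℕ), -(N:ℤ) ≤ (i-1) * ℓ → (i + m) * ℓ ≤ N →
        ∃ k : ℕ, 0 < k ∧ ∃ a : A (n+1+k), (factorAt w i m).IsInfix (sadicWordAux τ (n+1) k a)) := by
  obtain ⟨k, hk, a, ha⟩ := hy (-(N:ℤ)) (2*N+1)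
  obtain ⟨k, rfl⟩ : ∃ k', k = k' + 1 := ⟨k - 1, by omega⟩
  have hk1 : 0 < k := by
    rcases Nat.eq_zero_or_pos k with rfl | h
    · exfalso
      have := ha.length_le
      rw [factorAt_length] at this
      have h2 : (sadicWordAux τ n (0+1) a).length = ℓ := by
        simp [sadicWordAux]
        exact hl a
      omega
    · exact h
  obtain ⟨a', ha'⟩ := sadic_split τ n k a
  rw [ha'] at ha
  obtain ⟨pre, suf, hps⟩ := ha
  set u := sadicWordAux τ (n+1) k a' with hu
  have hval : ∀ t : ℕ, t < 2*N+1 → (u.flatMap (τ n))[pre.length + t]? = some (y (-(N:ℤ) + t)) := by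
    intro t ht
    rw [← hps, List.append_assoc, List.getElem?_append_right (by omega), Nat.add_sub_cancel_left,
      List.getElem?_append_left (by rw [factorAt_length]; exact ht), factorAt_getElem? _ _ _ _ ht]
  have hne : u ≠ [] := by
    intro h
    have := hval 0 (by omega)
    rw [h] at this
    simp at this
  obtain ⟨d⟩ : Nonempty (A (n+1)) := ⟨u.head hne⟩
  set q := (pre.length + N) / ℓ with hq
  set r := (pre.length + N) % ℓ with hr
  have hqr : q * ℓ + r = pre.length + N := by
    rw [hq, hr, mul_comm]; exact Nat.div_add_mod _ _
  have hqr' : (q:ℤ) * ℓ + r = pre.length + N := by exact_mod_cast hqr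
  have hrl : r < ℓ := Nat.mod_lt _ hpos
  have hin : ∀ (j : ℤ) (m : ℕ), m < ℓ → -(N:ℤ) ≤ j * ℓ + m - r → j * ℓ + m - r ≤ N →
      0 ≤ (q:ℤ) + j ∧ ∃ b, u[((q:ℤ) + j).toNat]? = some b ∧
        (τ n b)[m]? = some (y (j * ℓ + m - r)) := by
    intro j m hm h1 h2
    have hJ : 0 ≤ (q:ℤ) + j := by
      by_contra hneg
      have h3 : (q:ℤ) + j + 1 ≤ 0 := by omega
      have h4 : ((q:ℤ) + j + 1) * ℓ ≤ 0 := mul_nonpos_of_nonpos_of_nonneg h3 (by positivity)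
      have : ((q:ℤ) + j + 1) * ℓ = (q:ℤ) * ℓ + j * ℓ + ℓ := by ring
      omega
    refine ⟨hJ, ?_⟩
    obtain ⟨J, hJ'⟩ := Int.eq_ofNat_of_zero_le hJ
    have hjl : (J:ℤ) * ℓ = q * ℓ + j * ℓ := by rw [← hJ']; ring
    have ht : ∃ t : ℕ, (t:ℤ) = N + (j * ℓ + m - r) := ⟨(N + (j * ℓ + m - r)).toNat, by omega⟩
    obtain ⟨t, ht⟩ := ht
    have hidx : J * ℓ + m = pre.length + t := by
      zify
      linarith
    have h5 := hval t (by omega)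
    rw [← hidx, flatMap_getElem? hl _ _ _ hm] at h5
    rw [hJ']
    simp only [Int.toNat_natCast]
    rcases hub : u[J]? with _ | b
    · rw [hub] at h5; simp at h5
    · rw [hub] at h5
      refine ⟨b, rfl, ?_⟩
      simp only [Option.bind_some] at h5
      rw [h5]
      congr 2
      omega
  refine ⟨fun j => u.getD ((q:ℤ) + j).toNat d, r, hrl, ?_, ?_⟩
  · intro j m hm h1 h2
    obtain ⟨_, b, hb, hb2⟩ := hin j m hm h1 h2
    simp only [List.getD_eq_getElem?_getD, hb]
    exact hb2
  · intro i m h1 h2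
    refine ⟨k, hk1, a', ?_⟩
    rcases Nat.eq_zero_or_pos m with rfl | hmpos
    · have : factorAt (fun j => u.getD ((q:ℤ) + j).toNat d) i 0 = [] := by simp [factorAt_eq]
      rw [this]; exact List.nil_infix
    have good : ∀ j : ℤ, i ≤ j → j < i + m → 0 ≤ (q:ℤ) + j ∧ ((q:ℤ) + j).toNat < u.length := by
      intro j h3 h4
      have e1 : (i - 1) * ℓ ≤ (j - 1) * ℓ := by
        apply mul_le_mul_of_nonneg_right (by omega) (by positivity)
      have e2 : (j + 1) * ℓ ≤ (i + m) * ℓ := by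
        apply mul_le_mul_of_nonneg_right (by omega) (by positivity)
      have e3 : (j - 1) * ℓ = j * ℓ - ℓ := by ring
      have e4 : (j + 1) * ℓ = j * ℓ + ℓ := by ring
      obtain ⟨hh, b, hb, _⟩ := hin j 0 hpos (by push_cast; omega) (by push_cast; omega)
      refine ⟨hh, ?_⟩
      by_contra hcon
      rw [List.getElem?_eq_none (by omega)] at hb
      simp at hb
    have g0 := good i le_rfl (by omega)
    have g1 := good (i + m - 1) (by omega) (by omega)
    apply infix_of_getElem? _ _ ((q:ℤ) + i).toNat
    intro j hj
    · rw [factorAt_length] at hj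
      rw [factorAt_getElem? _ _ _ _ hj]
      have := good (i + j) (by omega) (by omega)
      have e : ((q:ℤ) + i).toNat + j = ((q:ℤ) + (i + j)).toNat := by omega
      rw [e, List.getD_eq_getElem?_getD, List.getElem?_eq_getElem this.2]
      simp


theorem desub {n : ℕ} {A : ℕ → Type} [Finite (A (n+1))] (τ : ∀ n, A (n+1) → List (A n)) (ℓ : ℕ)
    (hl : ∀ b, (τ n b).length = ℓ) (hpos : 0 < ℓ) {y : ℤ → A n} (hy : y ∈ XLevel τ n) :
    ∃ w ∈ XLevel τ (n+1), ∃ r < ℓ, IsEx (τ n) ℓ r w y := by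
  have H := fun N : ℕ => desub_fin τ n ℓ hl hpos hy (N + ℓ) (by omega)
  choose w r hr h1 h2 using H
  obtain ⟨z, hz⟩ := konig (fun N (i : ℤ) => ((w N i, (⟨r N, hr N⟩ : Fin ℓ)) : A (n+1) × Fin ℓ))
  have hzr : ∀ i, (z i).2 = (z 0).2 := by
    intro i
    obtain ⟨N, -, hN⟩ := hz i.natAbs
    rw [← hN i (by omega) (by omega), ← hN 0 (by omega) (by omega)]
  refine ⟨fun i => (z i).1, ?_, (z 0).2.1, (z 0).2.2, ?_⟩
  · intro i m
    obtain ⟨N, hN1, hN⟩ := hz ((i.natAbs + m + 1) * ℓ + i.natAbs + m)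
    have e : factorAt (fun i => (z i).1) i m = factorAt (w N) i m := by
      apply factorAt_congr
      intro j h3 h4
      have := hN j (by push_cast; nlinarith [abs_nonneg i, neg_abs_le i])
        (by push_cast; nlinarith [abs_nonneg i, le_abs_self i])
      rw [← this]
    rw [e]
    have hNN : (((i.natAbs:ℤ) + m + 1) * ℓ + i.natAbs + m) ≤ N := by exact_mod_cast hN1
    have hab : -(i.natAbs : ℤ) ≤ i ∧ i ≤ (i.natAbs:ℤ) := by omega
    apply h2 N
    · push_cast
      nlinarith [hab.1, hab.2]
    · push_cast
      nlinarith [hab.1, hab.2]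
  · intro j m hm
    obtain ⟨N, hN1, hN⟩ := hz ((j.natAbs + 1) * ℓ + j.natAbs)
    have hNN : (((j.natAbs:ℤ) + 1) * ℓ + j.natAbs) ≤ N := by exact_mod_cast hN1
    have hab : -(j.natAbs : ℤ) ≤ j ∧ j ≤ (j.natAbs:ℤ) := by omega
    have e1 := hN j (by push_cast; nlinarith [neg_abs_le j, le_abs_self j, abs_nonneg j])
      (by push_cast; nlinarith [neg_abs_le j, le_abs_self j, abs_nonneg j])
    have e2 := hN 0 (by push_cast; nlinarith [neg_abs_le j, le_abs_self j, abs_nonneg j])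
      (by push_cast; nlinarith [neg_abs_le j, le_abs_self j, abs_nonneg j])
    have hrN := hr N
    simp only []
    rw [← e1, ← e2]
    apply h1 N j m hm
    · push_cast
      nlinarith [hab.1, hab.2]
    · push_cast
      nlinarith [hab.1, hab.2]

theorem recog_local {n : ℕ} {A : ℕ → Type} [Finite (A n)] [Finite (A (n+1))]
    (τ : ∀ n, A (n+1) → List (A n)) (ℓ : ℕ)
    (hl : ∀ b, (τ n b).length = ℓ) (hrec : RecognizableIn (τ n) (XLevel τ (n+1))) :
    ∃ M : ℕ, ∀ (y y' : ℤ → A n) (w w' : ℤ → A (n+1)) (r r' : ℕ),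
      w ∈ XLevel τ (n+1) → w' ∈ XLevel τ (n+1) → r < ℓ → r' < ℓ →
      IsEx (τ n) ℓ r w y → IsEx (τ n) ℓ r' w' y' →
      (∀ i : ℤ, -(M:ℤ) ≤ i → i ≤ M → y i = y' i) → w 0 = w' 0 ∧ r = r' := by
  by_contra hcon
  push Not at hcon
  choose y y' w w' r r' hw hw' hr hr' hy hy' hag hne using hcon
  obtain ⟨z, hz⟩ := konig (fun N (i : ℤ) => (((w N i, (⟨r N, hr N⟩ : Fin ℓ)),
    (w' N i, (⟨r' N, hr' N⟩ : Fin ℓ))), y N i))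
  have hzr : ∀ i, (z i).1.1.2 = (z 0).1.1.2 ∧ (z i).1.2.2 = (z 0).1.2.2 := by
    intro i
    obtain ⟨N, -, hN⟩ := hz i.natAbs
    rw [← hN i (by omega) (by omega), ← hN 0 (by omega) (by omega)]
    exact ⟨rfl, rfl⟩
  have hW : (fun i => (z i).1.1.1) ∈ XLevel τ (n+1) := by
    apply XLevel_of_approx
    intro m
    obtain ⟨N, -, hN⟩ := hz m
    exact ⟨w N, hw N, fun i h1 h2 => by simp only [← hN i h1 h2]⟩
  have hW' : (fun i => (z i).1.2.1) ∈ XLevel τ (n+1) := by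
    apply XLevel_of_approx
    intro m
    obtain ⟨N, -, hN⟩ := hz m
    exact ⟨w' N, hw' N, fun i h1 h2 => by simp only [← hN i h1 h2]⟩
  have bnd : ∀ (j : ℤ) (m rr : ℕ), m < ℓ → rr < ℓ →
      -(((j.natAbs + 1) * ℓ + j.natAbs : ℕ):ℤ) ≤ j * ℓ + m - rr ∧
      j * ℓ + m - rr ≤ (((j.natAbs + 1) * ℓ + j.natAbs : ℕ):ℤ) := by
    intro j m rr hm hrr
    have hab : -(j.natAbs : ℤ) ≤ j ∧ j ≤ (j.natAbs:ℤ) := by omega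
    push_cast at *
    constructor <;> nlinarith [neg_abs_le j, le_abs_self j, abs_nonneg j]
  have hE : IsEx (τ n) ℓ (z 0).1.1.2.1 (fun i => (z i).1.1.1) (fun i => (z i).2) := by
    intro j m hm
    obtain ⟨N, hN1, hN⟩ := hz ((j.natAbs + 1) * ℓ + j.natAbs)
    have e1 := hN j (by omega) (by omega)
    have e2 := hN 0 (by omega) (by omega)
    have e3 := hN _ (bnd j m (r N) hm (hr N)).1 (bnd j m (r N) hm (hr N)).2
    have e4 : (z 0).1.1.2.1 = r N := by rw [← e2]
    simp only [e4]
    rw [← e3, ← e1]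
    exact hy N j m hm
  have hE' : IsEx (τ n) ℓ (z 0).1.2.2.1 (fun i => (z i).1.2.1) (fun i => (z i).2) := by
    intro j m hm
    obtain ⟨N, hN1, hN⟩ := hz ((j.natAbs + 1) * ℓ + j.natAbs)
    have e1 := hN j (by omega) (by omega)
    have e2 := hN 0 (by omega) (by omega)
    have e3 := hN _ (bnd j m (r' N) hm (hr' N)).1 (bnd j m (r' N) hm (hr' N)).2
    have e4 : (z 0).1.2.2.1 = r' N := by rw [← e2]
    simp only [e4]
    rw [← e3, ← e1]
    rw [hy' N j m hm]
    have b := bnd j m (r' N) hm (hr' N)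
    simp only []
    rw [hag N _ (by omega) (by omega)]
  obtain ⟨h1, h2⟩ := hrec _ _ _ _ _ (hE.centered hl (z 0).1.1.2.2 hW)
    (hE'.centered hl (z 0).1.2.2.2 hW')
  obtain ⟨N, -, hN⟩ := hz 0
  have e := hN 0 (by omega) (by omega)
  apply hne N
  · have := congrFun h1 0
    simp only [← e] at this
    exact this
  · simp only [← e] at h2
    exact h2

theorem lift_prox {n : ℕ} {A : ℕ → Type} [Finite (A n)] [Finite (A (n+1))]
    (τ : ∀ n, A (n+1) → List (A n)) (ℓ : ℕ) (hpos : 0 < ℓ)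
    (hl : ∀ b, (τ n b).length = ℓ) (hrec : RecognizableIn (τ n) (XLevel τ (n+1)))
    {y y' : ℤ → A n} {w w' : ℤ → A (n+1)} {r r' : ℕ} (hw : w ∈ XLevel τ (n+1))
    (hw' : w' ∈ XLevel τ (n+1)) (hr : r < ℓ) (hr' : r' < ℓ)
    (hE : IsEx (τ n) ℓ r w y) (hE' : IsEx (τ n) ℓ r' w' y') (hp : Prox y y') :
    r = r' ∧ Prox w w' := by
  obtain ⟨M, hM⟩ := recog_local τ ℓ hl hrec
  have hl0 : (0:ℤ) < ℓ := by exact_mod_cast hpos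
  have main : ∀ k : ℤ, (∀ i : ℤ, -(M:ℤ) ≤ i → i ≤ M → y (k + i) = y' (k + i)) →
      w ((r + k) / ℓ) = w' ((r' + k) / ℓ) ∧ (r + k) % ℓ = (r' + k) % ℓ := by
    intro k hk
    have e1 : ((r + k) / ℓ : ℤ) * ℓ = r - (((r + k) % ℓ).toNat : ℤ) + k := by
      rw [Int.toNat_of_nonneg (Int.emod_nonneg _ hl0.ne')]
      linarith [Int.ediv_mul_add_emod (r + k) ℓ]
    have e2 : ((r' + k) / ℓ : ℤ) * ℓ = r' - (((r' + k) % ℓ).toNat : ℤ) + k := by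
      rw [Int.toNat_of_nonneg (Int.emod_nonneg _ hl0.ne')]
      linarith [Int.ediv_mul_add_emod (r' + k) ℓ]
    have b1 := Int.emod_lt_of_pos (r + k) hl0
    have b2 := Int.emod_lt_of_pos (r' + k) hl0
    have c1 := Int.emod_nonneg (r + k) hl0.ne'
    have c2 := Int.emod_nonneg (r' + k) hl0.ne'
    obtain ⟨h1, h2⟩ := hM _ _ _ _ _ _ (XLevel_shiftBy τ _ hw _) (XLevel_shiftBy τ _ hw' _)
      (by omega) (by omega) (hE.shift k _ _ e1) (hE'.shift k _ _ e2)
      (fun i h1 h2 => by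
        have := hk i h1 h2
        simp only [shiftBy]
        rw [add_comm i k]; exact this)
    refine ⟨by simpa [shiftBy] using h1, by omega⟩
  have hrr : r = r' := by
    obtain ⟨k, hk⟩ := hp M
    have h := (main k hk).2
    have h2 : ((r:ℤ)) % ℓ = r' % ℓ := by
      have := Int.ModEq.add_right_cancel' k (show (r + k : ℤ) ≡ r' + k [ZMOD ℓ] from h)
      exact this
    rw [Int.emod_eq_of_lt (by omega) (by omega), Int.emod_eq_of_lt (by omega) (by omega)] at h2
    exact_mod_cast h2
  subst hrr
  refine ⟨rfl, fun m => ?_⟩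
  obtain ⟨k, hk⟩ := hp (M + m * ℓ)
  refine ⟨(r + k) / ℓ, fun i h1 h2 => ?_⟩
  have h3 : -((m:ℤ) * ℓ) ≤ i * ℓ := by nlinarith
  have h4 : i * ℓ ≤ (m:ℤ) * ℓ := by nlinarith
  have := (main (k + i * ℓ) (fun t h5 h6 => by
    rw [add_assoc]
    exact hk _ (by push_cast; omega) (by push_cast; omega))).1
  rw [← add_assoc, Int.add_mul_ediv_right _ _ hl0.ne'] at this
  exact this

/-- descending agreement, using properness -/
theorem agree_desc {n : ℕ} {A : ℕ → Type} (τ : ∀ n, A (n+1) → List (A n)) (ℓ : ℕ) (hpos : 0 < ℓ)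
    (hl : ∀ b, (τ n b).length = ℓ)
    (hprop : ∃ b c : A n, ∀ a : A (n+1), (τ n a).head? = some b ∧ (τ n a).getLast? = some c)
    {y y' : ℤ → A n} {w w' : ℤ → A (n+1)} {r : ℕ} (hr : r < ℓ)
    (hE : IsEx (τ n) ℓ r w y) (hE' : IsEx (τ n) ℓ r w' y') (m : ℕ)
    (h : ∀ i : ℤ, -(m:ℤ) ≤ i → i ≤ m → w i = w' i) :
    ∀ i : ℤ, -((m:ℤ)+1) ≤ i → i ≤ m+1 → y i = y' i := by
  intro i h1 h2
  have hl0 : (0:ℤ) < ℓ := by exact_mod_cast hpos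
  obtain ⟨b, c, hbc⟩ := hprop
  have b1 := Int.emod_lt_of_pos (r + i) hl0
  have c1 := Int.emod_nonneg (r + i) hl0.ne'
  have e := Int.ediv_mul_add_emod (r + i) ℓ
  set j := ((r:ℤ) + i) / ℓ with hj
  obtain ⟨o, ho⟩ := Int.eq_ofNat_of_zero_le c1
  rw [ho] at e b1
  have hol : o < ℓ := by omega
  have E1 := hE j o hol
  have E2 := hE' j o hol
  have ei : j * ℓ + o - r = i := by linarith
  rw [ei] at E1 E2
  have key : (τ n (w j))[o]? = (τ n (w' j))[o]? := by
    by_cases hA : -(m:ℤ) ≤ j ∧ j ≤ m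
    · rw [h j hA.1 hA.2]
    · have hA' : j < -(m:ℤ) ∨ (m:ℤ) < j := by omega
      rcases hA' with hA' | hA'
      · -- last letter
        have ho2 : o = ℓ - 1 := by
          have : (ℓ:ℤ) - 1 ≤ o := by nlinarith
          omega
        have hh : ∀ a : A (n+1), (τ n a)[o]? = some c := by
          intro a
          rw [← (hbc a).2, List.getLast?_eq_getElem?, hl, ho2]
        rw [hh, hh]
      · have ho2 : o = 0 := by
          have : (o:ℤ) ≤ 0 := by nlinarith
          omega
        have hh : ∀ a : A (n+1), (τ n a)[o]? = some b := by
          intro a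
          rw [← (hbc a).1, List.head?_eq_getElem?, ho2]
        rw [hh, hh]
  rw [E1, E2] at key
  exact Option.some.inj key

theorem no_triple {A : ℕ → Type} [∀ n, Fintype (A n)] (τ : ∀ n, A (n+1) → List (A n))
    (hne : NonErasing τ) (hcl : ConstantLength τ) (hprop : ProperSeq τ)
    (hrec : RecognizableSeq τ) (hrk : AlphabetRankLE A 2) (y : Fin 3 → ℤ → A 0)
    (hy : ∀ i, y i ∈ XLevel τ 0) (hp : ∀ i j, Prox (y i) (y j)) (hinj : Function.Injective y) :
    False := by
  have step : ∀ n : ℕ, ∃ v : Fin 3 → ℤ → A n, (∀ i, v i ∈ XLevel τ n) ∧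
      (∀ i j, Prox (v i) (v j)) ∧ ∀ (i j : Fin 3) (m : ℕ),
        (∀ t : ℤ, -(m:ℤ) ≤ t → t ≤ m → v i t = v j t) →
        (∀ t : ℤ, -((m + n : ℕ):ℤ) ≤ t → t ≤ ((m + n : ℕ):ℤ) → y i t = y j t) := by
    intro n
    induction n with
    | zero => exact ⟨y, hy, hp, fun i j m h => h⟩
    | succ n ih =>
      obtain ⟨v, hv, hvp, hva⟩ := ih
      have hex : ∃ ℓ, 0 < ℓ ∧ ∀ b, (τ n b).length = ℓ := by
        rcases isEmpty_or_nonempty (A (n+1)) with hE | ⟨⟨b⟩⟩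
        · exact ⟨1, one_pos, fun b => (hE.false b).elim⟩
        · exact ⟨(τ n b).length, List.length_pos_iff.2 (hne n b), fun b' => hcl n b' b⟩
      obtain ⟨ℓ, hpos, hl⟩ := hex
      have := fun i => desub τ ℓ hl hpos (hv i)
      choose w hw r hr hE using this
      have hlift := fun i j => lift_prox τ ℓ hpos hl (hrec n) (hw i) (hw j) (hr i) (hr j)
        (hE i) (hE j) (hvp i j)
      refine ⟨w, hw, fun i j => (hlift i j).2, fun i j m h => ?_⟩
      have h2 := hE j
      rw [← (hlift i j).1] at h2
      have h3 := agree_desc τ ℓ hpos hl (hprop n) (hr i) (hE i) h2 m h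
      have h4 := hva i j (m+1) (by push_cast; exact h3)
      intro t ht1 ht2
      exact h4 t (by push_cast at *; omega) (by push_cast at *; omega)
  have hdiff : ∀ i j : Fin 3, ∃ t : ℤ, i ≠ j → y i t ≠ y j t := by
    intro i j
    by_cases hij : i = j
    · exact ⟨0, fun h => (h hij).elim⟩
    · have : y i ≠ y j := fun h => hij (hinj h)
      obtain ⟨t, ht⟩ := Function.ne_iff.1 this
      exact ⟨t, fun _ => ht⟩
  choose t ht using hdiff
  obtain ⟨n, hn, hc⟩ := hrk (Finset.univ.sup (fun p : Fin 3 × Fin 3 => (t p.1 p.2).natAbs))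
  obtain ⟨v, -, -, hva⟩ := step n
  obtain ⟨i, j, hij, heq⟩ := Fintype.exists_ne_map_eq_of_card_lt (fun i : Fin 3 => v i 0)
    (by simp; omega)
  have h1 := hva i j 0 (fun s h1 h2 => by
    have : s = 0 := by push_cast at *; omega
    rw [this]; exact heq)
  have hb : (t i j).natAbs ≤ n :=
    le_trans (Finset.le_sup (f := fun p : Fin 3 × Fin 3 => (t p.1 p.2).natAbs)
      (Finset.mem_univ (i, j))) hn
  exact ht i j hij (h1 _ (by push_cast; omega) (by push_cast; omega))


/-! ### The example: the substitution and its recognizability -/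

/-- the substitution on two letters -/
def subw : Bool → List Bool
  | false => [true, true, false, false, false, true, false]
  | true => [true, true, false, false, true, false, false,
      true, true, false, true, false, false, false]

/-- the marker occurring exactly at the cuts -/
def Pat (x : ℤ → Bool) (q : ℤ) : Prop := x q = true ∧ x (q+1) = true ∧ x (q+3) = false

/-- a parsing of `x` into words `subw (y j)` starting at `c j` -/
def Parse (c : ℤ → ℤ) (y : ℤ → Bool) (x : ℤ → Bool) : Prop :=
  (∀ j, c (j+1) = c j + (subw (y j)).length) ∧
  ∀ (j : ℤ) (m : ℕ), m < (subw (y j)).length → (subw (y j))[m]? = some (x (c j + m))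

theorem subw_start (b : Bool) : 7 ≤ (subw b).length ∧ (subw b)[0]? = some true ∧
    (subw b)[1]? = some true ∧ (subw b)[2]? = some false ∧ (subw b)[3]? = some false := by
  cases b <;> simp [subw]

theorem Parse.ext4 {c y x} (h : Parse c y x) (j : ℤ) (m : ℕ)
    (hm : m < (subw (y j) ++ [true, true, false, false]).length) :
    (subw (y j) ++ [true, true, false, false])[m]? = some (x (c j + m)) := by
  by_cases h1 : m < (subw (y j)).length
  · rw [List.getElem?_append_left h1]
    exact h.2 j m h1
  · rw [List.getElem?_append_right (by omega)]
    simp only [List.length_append, List.length_cons, List.length_nil] at hm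
    obtain ⟨r, rfl⟩ := Nat.exists_eq_add_of_le (Nat.le_of_not_lt h1)
    have hs := subw_start (y (j+1))
    have h2 := h.2 (j+1) r (by omega)
    rw [h.1 j] at h2
    have e : c j + ((subw (y j)).length : ℤ) + (r:ℤ) =
      c j + (((subw (y j)).length + r : ℕ) : ℤ) := by push_cast; ring
    rw [e] at h2
    rw [← h2]
    have hr : r < 4 := by omega
    rw [Nat.add_sub_cancel_left]
    interval_cases r
    · rw [hs.2.1]; rfl
    · rw [hs.2.2.1]; rfl
    · rw [hs.2.2.2.1]; rfl
    · rw [hs.2.2.2.2]; rfl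

theorem pat_word (b : Bool) : ∀ m < (subw b).length,
    (((subw b ++ [true, true, false, false])[m]? = some true ∧
      (subw b ++ [true, true, false, false])[m+1]? = some true ∧
      (subw b ++ [true, true, false, false])[m+3]? = some false) ↔ m = 0) := by
  cases b <;> decide

theorem Parse.pat {c y x} (h : Parse c y x) (j : ℤ) (m : ℕ) (hm : m < (subw (y j)).length) :
    Pat x (c j + m) ↔ m = 0 := by
  rw [← pat_word (y j) m hm]
  have hl : (subw (y j) ++ [true, true, false, false]).length = (subw (y j)).length + 4 := by simp
  rw [h.ext4 j m (by omega), h.ext4 j (m+1) (by omega), h.ext4 j (m+3) (by omega)]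
  unfold Pat
  push_cast
  simp only [Option.some.injEq, add_assoc]

theorem Parse.patc {c y x} (h : Parse c y x) (j : ℤ) : Pat x (c j) := by
  have := (h.pat j 0 (by have := subw_start (y j); omega)).2 rfl
  simpa using this

theorem Parse.lt {c y x} (h : Parse c y x) (j : ℤ) : c j < c (j+1) := by
  have := subw_start (y j)
  have := h.1 j
  omega

theorem Parse.npat {c y x} (h : Parse c y x) (j q : ℤ) (h1 : c j < q) (h2 : q < c (j+1)) :
    ¬ Pat x q := by
  intro hp
  have h3 := h.1 j
  obtain ⟨m, hm⟩ := Int.eq_ofNat_of_zero_le (a := q - c j) (by omega)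
  have e : q = c j + m := by omega
  rw [e, h.pat j m (by omega)] at hp
  omega

theorem Parse.uniq {c y c' y' x} (h : Parse c y x) (h' : Parse c' y' x)
    (h0 : c 0 ≤ 0) (h1 : 0 < c 1) (h0' : c' 0 ≤ 0) (h1' : 0 < c' 1) : y = y' ∧ c 0 = c' 0 := by
  have e0 : c 0 = c' 0 := by
    rcases lt_trichotomy (c 0) (c' 0) with hh | hh | hh
    · exact absurd (h'.patc 0) (h.npat 0 _ hh (by rw [zero_add]; omega))
    · exact hh
    · exact absurd (h.patc 0) (h'.npat 0 _ hh (by rw [zero_add]; omega))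
  have fwd : ∀ j, c j = c' j → c (j+1) = c' (j+1) := by
    intro j hj
    rcases lt_trichotomy (c (j+1)) (c' (j+1)) with hh | hh | hh
    · exact absurd (h.patc (j+1)) (h'.npat j _ (by have := h.lt j; omega) hh)
    · exact hh
    · exact absurd (h'.patc (j+1)) (h.npat j _ (by have := h'.lt j; omega) hh)
  have bwd : ∀ j, c (j+1) = c' (j+1) → c j = c' j := by
    intro j hj
    rcases lt_trichotomy (c j) (c' j) with hh | hh | hh
    · exact absurd (h'.patc j) (h.npat j _ hh (by have := h'.lt j; omega))
    · exact hh
    · exact absurd (h.patc j) (h'.npat j _ hh (by have := h.lt j; omega))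
  have all : ∀ j, c j = c' j := by
    intro j
    induction j using Int.induction_on with
    | zero => exact e0
    | succ i ih => exact fwd _ ih
    | pred i ih => exact bwd _ (by simpa using ih)
  refine ⟨?_, e0⟩
  funext j
  have a := h.1 j
  have b := h'.1 j
  rw [all j, all (j+1), b] at a
  cases hy : y j <;> cases hy' : y' j <;> simp [hy, hy', subw] at a ⊢

theorem recog_subw (Y : Set (ℤ → Bool)) : RecognizableIn subw Y := by
  have key : ∀ (x y : ℤ → Bool) (k : ℕ), IsCenteredRep subw Y x y k →
      ∃ c, Parse c y x ∧ c 0 = -(k:ℤ) ∧ 0 < c 1 := by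
    rintro x y k ⟨-, hk, c, hc0, hc1, hc2⟩
    refine ⟨fun j => c j - k, ⟨?_, ?_⟩, by simp [hc0], ?_⟩
    · intro j
      simp only [hc1 j]; ring
    · intro j m hm
      have := hc2 j ⟨m, hm⟩
      simp only [List.get_eq_getElem] at this
      rw [List.getElem?_eq_getElem hm, ← this]
      congr 2; ring
    · have := hc1 0
      rw [hc0, zero_add] at this
      simp only [this]; omega
  intro x y y' k k' h h'
  obtain ⟨c, hc, h0, h1⟩ := key _ _ _ h
  obtain ⟨c', hc', h0', h1'⟩ := key _ _ _ h'
  obtain ⟨e1, e2⟩ := hc.uniq hc' (by omega) h1 (by omega) h1'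
  exact ⟨e1, by omega⟩

/-! ### The constant length lift on three letters -/

/-- the three level-zero words -/
def v0 : Fin 3 → List Bool :=
  ![[true, true, false, false, false, true, false],
    [true, true, false, false, true, false, false],
    [true, true, false, true, false, false, false]]

/-- the lifted substitution of constant length ten -/
def th : Fin 3 → List (Fin 3) :=
  ![[1, 2, 1, 2, 0, 0, 0, 1, 2, 0],
    [1, 2, 1, 2, 0, 0, 1, 2, 0, 0],
    [1, 2, 1, 2, 0, 1, 2, 0, 0, 0]]

/-- the words of level `n` -/
def V : ℕ → Fin 3 → List Bool
  | 0, e => v0 e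
  | (n+1), e => (th e).flatMap (V n)

/-- iterates of the two-letter substitution -/
def wd : ℕ → Bool → List Bool
  | 0, b => [b]
  | (n+1), b => (subw b).flatMap (wd n)

/-- common length of the words of level `n` -/
def Ln (n : ℕ) : ℕ := 7 * 10 ^ n

theorem Ln_succ (n : ℕ) : Ln (n+1) = 10 * Ln n := by unfold Ln; rw [pow_succ]; ring

theorem Ln_pos (n : ℕ) : 0 < Ln n := by unfold Ln; positivity

theorem Ln_gt (n : ℕ) : n < Ln n := by
  induction n with
  | zero => exact Ln_pos 0
  | succ n ih => rw [Ln_succ]; omega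

theorem V_length (n : ℕ) (e : Fin 3) : (V n e).length = Ln n := by
  induction n generalizing e with
  | zero => fin_cases e <;> rfl
  | succ n ih =>
    have : (V (n+1) e) = (th e).flatMap (V n) := rfl
    rw [this, List.length_flatMap]
    simp only [ih, List.map_const', List.sum_replicate, smul_eq_mul]
    rw [Ln_succ]
    congr 1
    fin_cases e <;> rfl

theorem wd_V (n : ℕ) : wd (n+1) false = V n 0 ∧ wd (n+1) true = V n 1 ++ V n 2 := by
  induction n with
  | zero => constructor <;> rfl
  | succ n ih =>
    have h1 : ∀ b, wd (n+1+1) b = (subw b).flatMap (wd (n+1)) := fun _ => rfl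
    have h2 : ∀ e, V (n+1) e = (th e).flatMap (V n) := fun _ => rfl
    rw [h1, h1, h2, h2, h2]
    constructor <;> simp [subw, th, ih.1, ih.2]

theorem sadic_wd (n k : ℕ) (b : Bool) :
    sadicWordAux (A := fun _ => Bool) (fun _ => subw) n k b = wd k b := by
  induction k generalizing b with
  | zero => rfl
  | succ k ih =>
    show (subw b).flatMap (sadicWordAux (A := fun _ => Bool) (fun _ => subw) n k) = _
    rw [show sadicWordAux (A := fun _ => Bool) (fun _ => subw) n k = wd k from funext ih]
    rfl

theorem V_block (n : ℕ) (e e' : Fin 3) (d j : ℕ) (hd : (th e)[d]? = some e') (hj : j < Ln n) :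
    (V (n+1) e)[d * Ln n + j]? = (V n e')[j]? := by
  have : (V (n+1) e) = (th e).flatMap (V n) := rfl
  rw [this, flatMap_getElem? (V_length n) _ _ _ hj, hd]
  rfl

theorem th_col4 (e : Fin 3) : (th e)[4]? = some 0 := by fin_cases e <;> rfl
theorem th_col6 (e : Fin 3) : (th e)[6]? = some e := by fin_cases e <;> rfl
theorem th_lt (e : Fin 3) (d : ℕ) (hd : d < 10) : ∃ e', (th e)[d]? = some e' := by
  have : (th e).length = 10 := by fin_cases e <;> rfl
  exact ⟨(th e)[d], List.getElem?_eq_getElem _⟩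

theorem V_col4 (n k : ℕ) (e : Fin 3) (q j : ℕ) (hq : q < 10 ^ k) (hj : j < Ln n) :
    (V (n+1+k) e)[q * (10 * Ln n) + 4 * Ln n + j]? = (V n 0)[j]? := by
  induction k generalizing e q with
  | zero =>
    have : q = 0 := by simpa using hq
    subst this
    rw [zero_mul, zero_add]
    exact V_block n e 0 4 j (th_col4 e) hj
  | succ k ih =>
    have hpos : 0 < 10 ^ k := by positivity
    have hd : q / 10 ^ k < 10 := by
      rw [Nat.div_lt_iff_lt_mul hpos]; rw [pow_succ] at hq; omega
    have hr : q % 10 ^ k < 10 ^ k := Nat.mod_lt _ hpos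
    obtain ⟨e', he'⟩ := th_lt e _ hd
    rw [← ih e' (q % 10 ^ k) hr]
    have hL : Ln (n+1+k) = 10 ^ k * (10 * Ln n) := by
      unfold Ln; rw [pow_add, pow_add]; ring
    have := V_block (n+1+k) e e' (q / 10^k) ((q % 10 ^ k) * (10 * Ln n) + 4 * Ln n + j) he' (by
      rw [hL]
      calc _ < (q % 10 ^ k) * (10 * Ln n) + 10 * Ln n := by omega
        _ = (q % 10 ^ k + 1) * (10 * Ln n) := by ring
        _ ≤ _ := Nat.mul_le_mul_right _ hr)
    rw [← this]
    congr 1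
    rw [hL]
    have e2 := Nat.div_add_mod q (10 ^ k)
    calc q * (10 * Ln n) + 4 * Ln n + j
        = (10 ^ k * (q / 10 ^ k) + q % 10 ^ k) * (10 * Ln n) + 4 * Ln n + j := by rw [e2]
      _ = _ := by ring

/-! ### Words occurring in points -/

/-- the word `l` occurs in `x` at position `s` -/
def At (x : ℤ → Bool) (s : ℤ) (l : List Bool) : Prop :=
  ∀ j : ℕ, j < l.length → l[j]? = some (x (s + j))

theorem At.subword {x s l} (h : At x s l) {u : List Bool} (hu : u <:+: l) : ∃ s', At x s' u := by
  obtain ⟨a, b, rfl⟩ := hu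
  refine ⟨s + a.length, ?_⟩
  intro j hj
  have := h (a.length + j) (by simp; omega)
  rw [List.append_assoc, List.getElem?_append_right (by omega), Nat.add_sub_cancel_left,
    List.getElem?_append_left hj] at this
  rw [this]
  congr 2; push_cast; ring

theorem At.factor {x s l} (h : At x s l) (i : ℤ) (m : ℕ) (h1 : s ≤ i)
    (h2 : i + m ≤ s + l.length) : factorAt x i m <:+: l := by
  apply infix_of_getElem? _ _ (i - s).toNat
  intro j hj
  rw [factorAt_length] at hj
  rw [factorAt_getElem? _ _ _ _ hj, h _ (by omega)]
  congr 2
  omega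

theorem At_factorAt {x y : ℤ → Bool} {s i : ℤ} {m : ℕ} (h : At x s (factorAt y i m)) (j : ℕ)
    (hj : j < m) : x (s + j) = y (i + j) := by
  have := h j (by rw [factorAt_length]; exact hj)
  rw [factorAt_getElem? _ _ _ _ hj] at this
  exact (Option.some.inj this).symm

/-- offsets of the nested blocks -/
def Tn (d : ℕ) : ℕ → ℕ
  | 0 => 0
  | (n+1) => Tn d n + d * Ln n

theorem Tn_ge (d : ℕ) (hd : 1 ≤ d) (n : ℕ) : n ≤ Tn d n := by
  induction n with
  | zero => exact Nat.zero_le _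
  | succ n ih =>
    have : Tn d (n+1) = Tn d n + d * Ln n := rfl
    have h2 : 1 * Ln n ≤ d * Ln n := Nat.mul_le_mul_right _ hd
    have := Ln_pos n
    omega

theorem Tn_le (d : ℕ) (hd : d ≤ 8) (n : ℕ) : Tn d n + n < Ln n := by
  induction n with
  | zero => exact Ln_pos 0
  | succ n ih =>
    have : Tn d (n+1) = Tn d n + d * Ln n := rfl
    have h2 : d * Ln n ≤ 8 * Ln n := Nat.mul_le_mul_right _ hd
    have := Ln_succ n
    omega

/-- the limit point of nested blocks -/
def pt (d : ℕ) (e : Fin 3) : ℤ → Bool := fun i =>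
  ((V (i.natAbs) e)[(i + Tn d i.natAbs).toNat]?).getD false

theorem nest (d : ℕ) (e : Fin 3) (hd : (th e)[d]? = some e) (n k : ℕ) (j : ℕ) (hj : j < Ln n) :
    ∃ j' : ℕ, j' < Ln (n+k) ∧ (j' : ℤ) - Tn d (n+k) = (j:ℤ) - Tn d n ∧
      (V (n+k) e)[j']? = (V n e)[j]? := by
  induction k with
  | zero => exact ⟨j, hj, rfl, rfl⟩
  | succ k ih =>
    obtain ⟨j', h1, h2, h3⟩ := ih
    have hlt : d < 10 := by
      have h4 : (th e).length = 10 := by fin_cases e <;> rfl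
      by_contra hcon
      rw [List.getElem?_eq_none (by omega)] at hd
      simp at hd
    refine ⟨d * Ln (n+k) + j', ?_, ?_, ?_⟩
    · have h5 : d * Ln (n+k) ≤ 9 * Ln (n+k) := Nat.mul_le_mul_right _ (by omega)
      have := Ln_succ (n+k)
      rw [← add_assoc]; omega
    · have : Tn d (n+(k+1)) = Tn d (n+k) + d * Ln (n+k) := rfl
      rw [this]; push_cast; linarith
    · rw [← h3]
      exact V_block (n+k) e e d j' hd h1

theorem nest2 (d : ℕ) (e : Fin 3) (hd : (th e)[d]? = some e) (n m : ℕ) (i : ℤ)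
    (h1 : -(Tn d n : ℤ) ≤ i) (h2 : i < -(Tn d n : ℤ) + Ln n)
    (h3 : -(Tn d m : ℤ) ≤ i) (h4 : i < -(Tn d m : ℤ) + Ln m) :
    (V n e)[(i + Tn d n).toNat]? = (V m e)[(i + Tn d m).toNat]? := by
  wlog hnm : n ≤ m generalizing n m
  · exact (this m n h3 h4 h1 h2 (by omega)).symm
  obtain ⟨k, rfl⟩ := Nat.exists_eq_add_of_le hnm
  obtain ⟨j', a, b, c⟩ := nest d e hd n k (i + Tn d n).toNat (by omega)
  rw [← c]
  congr 1
  omega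

theorem pt_at (d : ℕ) (e : Fin 3) (hd : (th e)[d]? = some e) (h1 : 1 ≤ d) (h8 : d ≤ 8) (n : ℕ) :
    At (pt d e) (-(Tn d n : ℤ)) (V n e) := by
  intro j hj
  rw [V_length] at hj
  unfold pt
  set i : ℤ := -(Tn d n : ℤ) + j with hi
  have a := Tn_ge d h1 i.natAbs
  have b := Tn_le d h8 i.natAbs
  rw [← nest2 d e hd n i.natAbs i (by omega) (by omega) (by omega) (by omega)]
  have : (i + Tn d n).toNat = j := by omega
  rw [this, List.getElem?_eq_getElem (by rw [V_length]; exact hj)]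
  rfl

/-- the example subshift -/
abbrev XX : Set (ℤ → Bool) := XLevel (A := fun _ => Bool) (fun _ => subw) 0

theorem V_infix_wd (n : ℕ) (e : Fin 3) : ∃ b, V n e <:+: wd (n+1) b := by
  obtain ⟨h1, h2⟩ := wd_V n
  fin_cases e
  · exact ⟨false, by rw [h1]; exact List.infix_rfl⟩
  · exact ⟨true, by rw [h2]; exact (List.prefix_append _ _).isInfix⟩
  · exact ⟨true, by rw [h2]; exact (List.suffix_append _ _).isInfix⟩

theorem wd_infix_V (n : ℕ) (b : Bool) : wd (n+1) b <:+: V (n+1) 0 := by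
  obtain ⟨h1, h2⟩ := wd_V n
  have h3 : V (n+1) 0 = (th 0).flatMap (V n) := rfl
  cases b
  · rw [h1, h3]
    exact ⟨V n 1 ++ V n 2 ++ V n 1 ++ V n 2, V n 0 ++ V n 0 ++ V n 1 ++ V n 2 ++ V n 0,
      by simp [th]⟩
  · rw [h2, h3]
    exact ⟨[], V n 1 ++ V n 2 ++ V n 0 ++ V n 0 ++ V n 0 ++ V n 1 ++ V n 2 ++ V n 0,
      by simp [th]⟩

theorem pt_mem (d : ℕ) (e : Fin 3) (hd : (th e)[d]? = some e) (h1 : 1 ≤ d) (h8 : d ≤ 8) :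
    pt d e ∈ XX := by
  intro i m
  have a := Tn_ge d h1 (i.natAbs + m)
  have b := Tn_le d h8 (i.natAbs + m)
  have h := (pt_at d e hd h1 h8 (i.natAbs + m)).factor i m (by omega)
    (by rw [V_length]; omega)
  obtain ⟨c, hc⟩ := V_infix_wd (i.natAbs + m) e
  refine ⟨i.natAbs + m + 1, by omega, c, ?_⟩
  rw [sadic_wd]
  exact h.trans hc

theorem pt_prox (e e' : Fin 3) : Prox (pt 6 e) (pt 6 e') := by
  intro m
  have key : ∀ (e : Fin 3) (j : ℕ), j < Ln (2*m+1) →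
      (V (2*m+1) 0)[j]? = some (pt 6 e (-(Tn 6 (2*m+1+1) : ℤ) + (4 * Ln (2*m+1) + j : ℕ))) := by
    intro e j hj
    rw [← V_block (2*m+1) e 0 4 j (th_col4 e) hj]
    apply pt_at 6 e (th_col6 e) (by norm_num) (by norm_num)
    have hs := Ln_succ (2*m+1)
    rw [V_length, hs]; omega
  have hL := Ln_gt (2*m+1)
  refine ⟨-(Tn 6 (2*m+1+1) : ℤ) + (4 * Ln (2*m+1) + m : ℕ), fun i h1 h2 => ?_⟩
  have hj : (m + i).toNat < Ln (2*m+1) := by omega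
  have a := key e _ hj
  have b := key e' _ hj
  rw [a] at b
  have e1 : -(Tn 6 (2*m+1+1) : ℤ) + (4 * Ln (2*m+1) + m : ℕ) + i =
      -(Tn 6 (2*m+1+1) : ℤ) + (4 * Ln (2*m+1) + (m+i).toNat : ℕ) := by omega
  rw [e1]
  exact Option.some.inj b

theorem pt_inj : Function.Injective (pt 6) := by
  intro e e' h
  have key : ∀ (e : Fin 3) (j : ℕ), j < 7 → (v0 e)[j]? = some (pt 6 e j) := by
    intro e j hj
    have := pt_at 6 e (th_col6 e) (by norm_num) (by norm_num) 0 j (by rw [V_length]; exact hj)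
    simpa [Tn, V] using this
  have h2 : v0 e = v0 e' := by
    apply List.ext_getElem?
    intro j
    by_cases hj : j < 7
    · rw [key e j hj, key e' j hj, h]
    · have := V_length 0
      have l1 : (v0 e).length = 7 := this e
      have l2 : (v0 e').length = 7 := this e'
      rw [List.getElem?_eq_none (by omega), List.getElem?_eq_none (by omega)]
  revert h2
  fin_cases e <;> fin_cases e' <;> simp [v0]

/-! ### The Toeplitz point -/

/-- the Toeplitz point -/
def xT : ℤ → Bool := pt 4 0

/-- auxiliary counter -/
def cc : ℕ → ℕ
  | 0 => 0
  | (k+1) => cc k + 4 * 10 ^ k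

theorem cc_ge (k : ℕ) : k ≤ cc k := by
  induction k with
  | zero => exact Nat.zero_le _
  | succ k ih =>
    have : cc (k+1) = cc k + 4 * 10 ^ k := rfl
    have : 0 < 10 ^ k := by positivity
    omega

theorem cc_le (k : ℕ) : cc k + k < 10 ^ k := by
  induction k with
  | zero => decide
  | succ k ih =>
    have : cc (k+1) = cc k + 4 * 10 ^ k := rfl
    have := pow_succ 10 k
    omega

theorem Tn_cc (n k : ℕ) : Tn 4 (n+1+k) = Tn 4 n + 4 * Ln n + cc k * (10 * Ln n) := by
  induction k with
  | zero => simp [cc, Tn]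
  | succ k ih =>
    have h1 : Tn 4 (n+1+(k+1)) = Tn 4 (n+1+k) + 4 * Ln (n+1+k) := rfl
    have h2 : cc (k+1) = cc k + 4 * 10 ^ k := rfl
    have hL : Ln (n+1+k) = 10 ^ k * (10 * Ln n) := by
      unfold Ln; rw [pow_add, pow_add]; ring
    rw [h1, h2, ih, hL]; ring

theorem xT_at0 (n : ℕ) : At xT (-(Tn 4 n : ℤ)) (V n 0) :=
  pt_at 4 0 (th_col4 0) (by norm_num) (by norm_num) n

theorem xT_at (n : ℕ) (k : ℤ) : At xT (-(Tn 4 n : ℤ) + k * (10 * Ln n : ℕ)) (V n 0) := by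
  intro j hj
  rw [V_length] at hj
  have a := cc_ge k.natAbs
  have b := cc_le k.natAbs
  obtain ⟨q, hq⟩ := Int.eq_ofNat_of_zero_le (a := cc k.natAbs + k) (by omega)
  have hq2 : q < 10 ^ k.natAbs := by
    have : (q:ℤ) < ((10 ^ k.natAbs : ℕ) : ℤ) := by omega
    exact_mod_cast this
  rw [← V_col4 n k.natAbs 0 q j hq2 hj]
  have hlen : q * (10 * Ln n) + 4 * Ln n + j < (V (n+1+k.natAbs) 0).length := by
    rw [V_length]
    have hL : Ln (n+1+k.natAbs) = 10 ^ k.natAbs * (10 * Ln n) := by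
      unfold Ln; rw [pow_add, pow_add]; ring
    rw [hL]
    calc _ < q * (10 * Ln n) + 10 * Ln n := by omega
        _ = (q + 1) * (10 * Ln n) := by ring
        _ ≤ _ := Nat.mul_le_mul_right _ hq2
  rw [xT_at0 (n+1+k.natAbs) _ hlen]
  congr 2
  rw [Tn_cc]
  have : (k:ℤ) = (q:ℤ) - cc k.natAbs := by
    have : (Int.ofNat q) = (q:ℤ) := rfl
    omega
  conv_rhs => rw [this]
  push_cast
  ring

theorem xT_toeplitz : IsToeplitz xT := by
  intro i
  have a := Tn_ge 4 (by norm_num) i.natAbs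
  have b := Tn_le 4 (by norm_num) i.natAbs
  have hp := Ln_pos i.natAbs
  refine ⟨10 * Ln i.natAbs, by omega, ?_⟩
  intro k
  have hj : (i + Tn 4 i.natAbs).toNat < (V i.natAbs 0).length := by
    rw [V_length]; omega
  have h1 := xT_at i.natAbs k _ hj
  have h2 := xT_at0 i.natAbs _ hj
  rw [h1] at h2
  have h3 := Option.some.inj h2
  have e1 : i + k * (10 * Ln i.natAbs : ℕ) =
      -(Tn 4 i.natAbs : ℤ) + k * (10 * Ln i.natAbs : ℕ) + ((i + Tn 4 i.natAbs).toNat : ℕ) := by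
    rw [Int.toNat_of_nonneg (by omega)]; ring
  have e2 : -(Tn 4 i.natAbs : ℤ) + ((i + Tn 4 i.natAbs).toNat : ℕ) = i := by
    rw [Int.toNat_of_nonneg (by omega)]; ring
  rw [e1, h3, e2]

theorem XX_approx {y : ℤ → Bool} (hy : y ∈ XX) (m : ℕ) :
    ∃ s : ℤ, ∀ i : ℤ, -(m:ℤ) ≤ i → i ≤ m → xT (i + s) = y i := by
  obtain ⟨k, hk, b, hb⟩ := hy (-(m:ℤ)) (2*m+1)
  rw [sadic_wd] at hb
  obtain ⟨n, rfl⟩ : ∃ n, k = n+1 := ⟨k-1, by omega⟩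
  obtain ⟨s, hs⟩ := (xT_at0 (n+1)).subword (hb.trans (wd_infix_V n b))
  refine ⟨s + m, fun i h1 h2 => ?_⟩
  have := At_factorAt hs (i + m).toNat (by omega)
  rw [Int.toNat_of_nonneg (by omega)] at this
  rw [show i + (s + m) = s + (i + m) by ring, this]
  congr 1; ring

theorem XX_closure [TopologicalSpace Bool] [DiscreteTopology Bool] : XX = closure (orbit xT) := by
  apply Set.Subset.antisymm
  · intro y hy
    rw [mem_closure_cyl]
    intro m
    obtain ⟨s, hs⟩ := XX_approx hy m
    exact ⟨shiftBy s xT, ⟨s, rfl⟩, hs⟩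
  · intro y hy
    rw [mem_closure_cyl] at hy
    apply XLevel_of_approx (A := fun _ => Bool)
    intro m
    obtain ⟨s, ⟨k, rfl⟩, hs⟩ := hy m
    exact ⟨_, XLevel_shiftBy (A := fun _ => Bool) _ 0
      (pt_mem 4 0 (th_col4 0) (by norm_num) (by norm_num)) k, hs⟩

theorem XX_occ {y : ℤ → Bool} (hy : y ∈ XX) (n : ℕ) : ∃ s, At y s (V n 0) := by
  obtain ⟨s, hs⟩ := XX_approx hy (20 * Ln n)
  have hp := Ln_pos n
  have b := Tn_le 4 (by norm_num) n
  obtain ⟨k, hk1, hk2⟩ : ∃ k : ℤ, s ≤ k * (10 * Ln n : ℕ) ∧ k * (10 * Ln n : ℕ) ≤ s + 10 * Ln n := by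
    refine ⟨s / (10 * Ln n : ℕ) + 1, ?_, ?_⟩
    · have h1 := Int.lt_ediv_add_one_mul_self s (b := ((10 * Ln n : ℕ):ℤ)) (by omega)
      exact h1.le
    · have h1 := Int.ediv_mul_le s (b := ((10 * Ln n : ℕ):ℤ)) (by omega)
      rw [add_mul, one_mul]
      push_cast at *
      linarith
  refine ⟨-(Tn 4 n : ℤ) + k * (10 * Ln n : ℕ) - s, ?_⟩
  intro j hj
  rw [xT_at n k j hj]
  rw [V_length] at hj
  rw [← hs _ (by omega) (by omega)]
  congr 2
  ring

theorem XX_aper {y : ℤ → Bool} (hy : y ∈ XX) : IsAperiodicPoint y := by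
  rintro ⟨q, hq, hper⟩
  have per0 : ∀ n j, j + q < Ln n → (V n 0)[j + q]? = (V n 0)[j]? := by
    intro n j hj
    obtain ⟨s, hs⟩ := XX_occ hy n
    rw [hs (j+q) (by rw [V_length]; exact hj), hs j (by rw [V_length]; omega)]
    congr 1
    rw [← hper (s + j)]
    congr 1; push_cast; ring
  have per : ∀ n e j, j + q < Ln n → (V n e)[j + q]? = (V n e)[j]? := by
    intro n e j hj
    obtain ⟨d, hd, hd10⟩ : ∃ d, (th 0)[d]? = some e ∧ d < 10 := by
      fin_cases e
      · exact ⟨4, rfl, by norm_num⟩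
      · exact ⟨0, rfl, by norm_num⟩
      · exact ⟨1, rfl, by norm_num⟩
    rw [← V_block n 0 e d _ hd hj, ← V_block n 0 e d j hd (by omega), ← add_assoc]
    apply per0
    have : d * Ln n ≤ 9 * Ln n := Nat.mul_le_mul_right _ (by omega)
    rw [Ln_succ]; omega
  have hqL := Ln_gt q
  have main : ∀ j, j < 3 * Ln q →
      (V (q+1) 0)[4 * Ln q + j]? = (V (q+1) 1)[4 * Ln q + j]? := by
    intro j
    induction j using Nat.strong_induction_on with
    | _ j ih =>
      intro hj
      by_cases h : j < Ln q
      · rw [V_block q 0 0 4 j rfl h, V_block q 1 0 4 j rfl h]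
      · obtain ⟨r, rfl⟩ : ∃ r, j = r + q := ⟨j - q, by omega⟩
        have hL := Ln_succ q
        rw [← add_assoc, per (q+1) 0 _ (by omega), per (q+1) 1 _ (by omega)]
        exact ih r (by omega) (by omega)
  have hV : ∀ j < Ln q, (V q 0)[j]? = (V q 1)[j]? := by
    intro j hj
    have := main (2 * Ln q + j) (by omega)
    rw [show 4 * Ln q + (2 * Ln q + j) = 6 * Ln q + j by ring] at this
    rwa [V_block q 0 0 6 j rfl hj, V_block q 1 1 6 j rfl hj] at this
  obtain ⟨a, a1, a2, a3⟩ := nest 6 0 (th_col6 0) 0 q 4 (by decide)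
  obtain ⟨b, b1, b2, b3⟩ := nest 6 1 (th_col6 1) 0 q 4 (by decide)
  have hab : a = b := by omega
  subst hab
  rw [Nat.zero_add] at a1 a3 b3
  rw [← hV a a1, a3] at b3
  revert b3
  decide

theorem wd_one_mem : ∀ a b : Bool, b ∈ wd 1 a := by decide

theorem subw_ends : ∀ a : Bool, (subw a).head? = some true ∧ (subw a).getLast? = some false := by
  decide

/-- There is a primitive, proper and recognizable directive sequence on
2-letter alphabets, with `A 0 = {0,1}`, whose S-adic subshift is an aperiodic Toeplitz
subshift (hence of topological rank 2) which is not a strong Toeplitz subshift of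
rank 2. -/
theorem statement2 :
    ∃ (A : ℕ → Type) (iA : ∀ n, Fintype (A n)) (τ : ∀ n, A (n+1) → List (A n)),
      A 0 = Bool ∧ (∀ n, Fintype.card (A (n+1)) = 2) ∧
      NonErasing τ ∧ PrimitiveSeq τ ∧ ProperSeq τ ∧ RecognizableSeq τ ∧
      (@IsToeplitzSubshift (A 0) ⊥ (XLevel τ 0)) ∧
      (∀ x ∈ XLevel τ 0, IsAperiodicPoint x) ∧
      ¬ @IsStrongToeplitzOfRank (A 0) ⊥ (XLevel τ 0) 2 := by
  refine ⟨fun _ => Bool, fun _ => inferInstance, fun _ => subw, rfl, fun _ => rfl, ?_, ?_, ?_, ?_,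
    ?_, ?_, ?_⟩
  · intro n a
    cases a <;> simp [subw]
  · intro n
    refine ⟨1, one_pos, fun a b => ?_⟩
    rw [sadic_wd]
    exact wd_one_mem a b
  · intro n
    exact ⟨true, false, subw_ends⟩
  · intro n
    exact recog_subw _
  · let tB : TopologicalSpace Bool := ⊥
    have hB : DiscreteTopology Bool := ⟨rfl⟩
    exact ⟨xT, xT_toeplitz, XX_closure⟩
  · intro x hx
    exact XX_aper hx
  · rintro ⟨B, iB, σ, hne, hcl, -, hprop, hrec, hrk, hconj⟩
    obtain ⟨y, hy, hp, hinj⟩ := conj_prox (A := fun _ => Bool) (fun _ => subw) (XLevel σ 0) hconj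
      (pt 6) (fun e => pt_mem 6 e (th_col6 e) (by norm_num) (by norm_num)) pt_prox pt_inj
    exact no_triple σ hne hcl hprop hrec hrk y hy hp hinj

end ToeplitzFR
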